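/- arXiv:2502.11243 — 2 statements merged into one kernel-verified Lean document; each statement's English description precedes it below -/
import Mathlib

section
/- Let S be a solution concept that permits bracketing and satisfies distribution-monotonicity, anonymity, scale-invariance, and interiority. Then there exists λ=(λ_1,λ_2,λ_3)∈ℝ³_{≥0} such that every solution of every game is a Min-Max-Mean_λ equilibrium (S is a refinement of Min-Max-Mean_λ). -/
open Filter Topology MeasureTheory

noncomputable section

namespace Paper

/-! ## Lotteries as finitely supported probability mass functions on ℝ -/

open Classical in
/-- The point mass at `a`. -/
def delta {α : Type*} (a : α) : α → ℝ := fun b => if b = a then 1 else 0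

/-- `f` is (the p.m.f. of) a finitely supported lottery. -/
def IsFinLottery (f : ℝ → ℝ) : Prop :=
  (∀ x, 0 ≤ f x) ∧ (Function.support f).Finite ∧ ∑ᶠ x, f x = 1

/-- The CDF of a mass function. -/
def cdfOf (f : ℝ → ℝ) (t : ℝ) : ℝ := ∑ᶠ x, if x ≤ t then f x else 0

/-- Convolution: the distribution of the sum of independent draws. -/
def conv (f g : ℝ → ℝ) : ℝ → ℝ := fun z => ∑ᶠ x, f x * g (z - x)

/-- Expectation of a finitely supported lottery. -/
def expOf (f : ℝ → ℝ) : ℝ := ∑ᶠ x, x * f x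

/-- Weak first-order stochastic dominance of `f` over `g`. -/
def FOSDgeF (f g : ℝ → ℝ) : Prop := ∀ t, cdfOf f t ≤ cdfOf g t

/-- Strict first-order stochastic dominance of `f` over `g`. -/
def FOSDgtF (f g : ℝ → ℝ) : Prop := FOSDgeF f g ∧ f ≠ g

/-- Finitely supported lotteries with rational-valued CDF (`Δ_ℚ`). -/
def IsDeltaQ (f : ℝ → ℝ) : Prop := IsFinLottery f ∧ ∀ t, ∃ q : ℚ, cdfOf f t = (q : ℝ)

/-- Monotone additive statistic on all finitely supported lotteries. -/
def MAS (Φ : (ℝ → ℝ) → ℝ) : Prop :=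
  (∀ c : ℝ, Φ (delta c) = c) ∧
  (∀ f g, IsFinLottery f → IsFinLottery g → Φ (conv f g) = Φ f + Φ g) ∧
  (∀ f g, IsFinLottery f → IsFinLottery g → FOSDgeF f g → Φ g ≤ Φ f)

/-- Monotone additive statistic on `Δ_ℚ`. -/
def MASQ (Φ : (ℝ → ℝ) → ℝ) : Prop :=
  (∀ c : ℝ, Φ (delta c) = c) ∧
  (∀ f g, IsDeltaQ f → IsDeltaQ g → Φ (conv f g) = Φ f + Φ g) ∧
  (∀ f g, IsDeltaQ f → IsDeltaQ g → FOSDgeF f g → Φ g ≤ Φ f)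

/-- The statistic `K_a` for `a` in the extended real line. -/
def Kstat (a : EReal) (f : ℝ → ℝ) : ℝ :=
  if a = ⊤ then sSup (Function.support f)
  else if a = ⊥ then sInf (Function.support f)
  else if a = 0 then expOf f
  else (a.toReal)⁻¹ * Real.log (∑ᶠ x, Real.exp (a.toReal * x) * f x)

/-- `K_a` for real `a`. -/
def Kreal (a : ℝ) : (ℝ → ℝ) → ℝ := Kstat (a : EReal)

/-- The statistic `Φ[X] = ∫ K_a[X] dμ(a)`. -/
def PhiInt (μ : Measure EReal) (f : ℝ → ℝ) : ℝ := ∫ a, Kstat a f ∂μ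

/-! ## Finite normal-form games -/

structure Game (N : ℕ) where
  A : Fin N → Type
  fintypeA : ∀ i, Fintype (A i)
  nonemptyA : ∀ i, Nonempty (A i)
  u : ((i : Fin N) → A i) → Fin N → ℝ

instance {N : ℕ} (G : Game N) (i : Fin N) : Fintype (G.A i) := G.fintypeA i
instance {N : ℕ} (G : Game N) (i : Fin N) : Nonempty (G.A i) := G.nonemptyA i

/-- A (mixed strategy) profile: a real-valued function on each action set. -/
abbrev Profile {N : ℕ} (G : Game N) := (i : Fin N) → G.A i → ℝ

/-- `p` is a mixed strategy profile. -/
def IsMixed {N : ℕ} (G : Game N) (p : Profile G) : Prop :=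
  ∀ i, (∀ ai, 0 ≤ p i ai) ∧ ∑ ai, p i ai = 1

/-- Probability of the full action profile `a` under independent mixing `p`. -/
def weight {N : ℕ} (G : Game N) (p : Profile G) (a : (i : Fin N) → G.A i) : ℝ :=
  ∏ j, p j (a j)

/-- The p.m.f. of player `i`'s payoff lottery `u_i(a_i, p_{-i})`. -/
def payMass {N : ℕ} (G : Game N) (p : Profile G) (i : Fin N) (ai : G.A i) : ℝ → ℝ :=
  fun t => ∑ a : (j : Fin N) → G.A j,
    if G.u a i = t then weight G (Function.update p i (delta ai)) a else 0

/-- Expected payoff `E[u_i(a_i, p_{-i})]`. -/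
def expPay {N : ℕ} (G : Game N) (p : Profile G) (i : Fin N) (ai : G.A i) : ℝ :=
  ∑ a : (j : Fin N) → G.A j, weight G (Function.update p i (delta ai)) a * G.u a i

/-- Expected value of `f` applied to player `i`'s payoff lottery. -/
def expPayOf {N : ℕ} (G : Game N) (p : Profile G) (i : Fin N) (ai : G.A i) (f : ℝ → ℝ) : ℝ :=
  ∑ a : (j : Fin N) → G.A j, weight G (Function.update p i (delta ai)) a * f (G.u a i)

/-- Minimum over `a_{-i}` of `u_i(a_i, a_{-i})`. -/
def minPay {N : ℕ} (G : Game N) (i : Fin N) (ai : G.A i) : ℝ :=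
  ⨅ a : (j : Fin N) → G.A j, G.u (Function.update a i ai) i

/-- Maximum over `a_{-i}` of `u_i(a_i, a_{-i})`. -/
def maxPay {N : ℕ} (G : Game N) (i : Fin N) (ai : G.A i) : ℝ :=
  ⨆ a : (j : Fin N) → G.A j, G.u (Function.update a i ai) i

/-- `a_i` is strictly dominated (by some `b_i`). -/
def StrictlyDominated {N : ℕ} (G : Game N) (i : Fin N) (ai : G.A i) : Prop :=
  ∃ bi : G.A i, ∀ a : (j : Fin N) → G.A j,
    G.u (Function.update a i ai) i < G.u (Function.update a i bi) i

/-! ## Solution concepts and axioms -/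

abbrev SolCon (N : ℕ) := (G : Game N) → Set (Profile G)

/-- A solution concept assigns to each game a nonempty set of mixed strategy profiles. -/
def IsSolutionConcept {N : ℕ} (S : SolCon N) : Prop :=
  ∀ G, (S G).Nonempty ∧ ∀ p ∈ S G, IsMixed G p

/-- The composite game `G ⊗ H`. -/
def Game.comp {N : ℕ} (G H : Game N) : Game N where
  A := fun i => G.A i × H.A i
  fintypeA := fun i => inferInstance
  nonemptyA := fun i => inferInstance
  u := fun c i => G.u (fun j => (c j).1) i + H.u (fun j => (c j).2) i

/-- The product profile `p × q`. -/
def prodProfile {N : ℕ} {G H : Game N} (p : Profile G) (q : Profile H) :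
    Profile (G.comp H) := fun i ab => p i ab.1 * q i ab.2

def Bracketing {N : ℕ} (S : SolCon N) : Prop :=
  ∀ (G H : Game N) (p : Profile G) (q : Profile H),
    p ∈ S G → q ∈ S H → prodProfile p q ∈ S (G.comp H)

/-- The permuted game `G_π`. -/
def Game.permute {N : ℕ} (G : Game N) (π : Equiv.Perm (Fin N)) : Game N where
  A := fun i => G.A (π i)
  fintypeA := fun i => G.fintypeA (π i)
  nonemptyA := fun i => G.nonemptyA (π i)
  u := fun b i =>
    G.u (fun j => cast (congrArg G.A (π.apply_symm_apply j)) (b (π.symm j))) (π i)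

def Anonymity {N : ℕ} (S : SolCon N) : Prop :=
  ∀ (π : Equiv.Perm (Fin N)) (G : Game N) (p : Profile G),
    p ∈ S G → (fun i => p (π i)) ∈ S (G.permute π)

def ExpectationMonotone {N : ℕ} (S : SolCon N) : Prop :=
  ∀ G, ∀ p ∈ S G, ∀ i, ∀ ai bi : G.A i,
    expPay G p i bi < expPay G p i ai → p i bi ≤ p i ai

def ExpectationNeutral {N : ℕ} (S : SolCon N) : Prop :=
  ∀ G, ∀ p ∈ S G, ∀ i, ∀ ai bi : G.A i,
    expPay G p i ai = expPay G p i bi → p i ai = p i bi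

def DistributionMonotone {N : ℕ} (S : SolCon N) : Prop :=
  ∀ G, ∀ p ∈ S G, ∀ i, ∀ ai bi : G.A i,
    FOSDgtF (payMass G p i ai) (payMass G p i bi) → p i bi ≤ p i ai

def Interiority {N : ℕ} (S : SolCon N) : Prop :=
  ∀ G, ∀ p ∈ S G, ∀ i, ∀ ai : G.A i, 0 < p i ai

/-- The game with payoffs rescaled by `α`. -/
def Game.scale {N : ℕ} (G : Game N) (α : ℝ) : Game N :=
  { G with u := fun a i => α * G.u a i }

def ScaleInvariant {N : ℕ} (S : SolCon N) : Prop :=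
  ∀ G : Game N, ∀ p ∈ S G,
    (∀ i, ∀ ai : G.A i, p i ai = ((Fintype.card (G.A i) : ℝ))⁻¹) →
    ∀ α ∈ Set.Ioo (0 : ℝ) 1, p ∈ S (G.scale α)

def StratInvariant {N : ℕ} (S : SolCon N) : Prop :=
  ∀ (G : Game N) (u' : ((i : Fin N) → G.A i) → Fin N → ℝ),
    (∀ i, ∃ w : ((j : Fin N) → G.A j) → ℝ,
      (∀ a, ∀ bi : G.A i, w (Function.update a i bi) = w a) ∧
      (∀ a, u' a i = G.u a i + w a)) →
    S G = S { G with u := u' }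

/-! ## Equilibrium notions -/

def IsNash {N : ℕ} (G : Game N) (p : Profile G) : Prop :=
  ∀ i, ∀ ai : G.A i, 0 < p i ai → ∀ bi : G.A i, expPay G p i bi ≤ expPay G p i ai

def IsLQRE {N : ℕ} (lam : ℝ) (G : Game N) (p : Profile G) : Prop :=
  ∀ i, ∀ ai : G.A i,
    p i ai = Real.exp (lam * expPay G p i ai) / ∑ bi, Real.exp (lam * expPay G p i bi)

def IsNashPhi {N : ℕ} (Φ : (ℝ → ℝ) → ℝ) (G : Game N) (p : Profile G) : Prop :=
  ∀ i, ∀ ai : G.A i, 0 < p i ai → ∀ bi : G.A i,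
    Φ (payMass G p i bi) ≤ Φ (payMass G p i ai)

def IsLQREPhi {N : ℕ} (Φ : (ℝ → ℝ) → ℝ) (lam : ℝ) (G : Game N) (p : Profile G) : Prop :=
  ∀ i, ∀ ai : G.A i,
    p i ai = Real.exp (lam * Φ (payMass G p i ai)) /
      ∑ bi, Real.exp (lam * Φ (payMass G p i bi))

def IsFOSDNash {N : ℕ} (G : Game N) (p : Profile G) : Prop :=
  ∀ i, ∀ ai : G.A i,
    (∃ bi : G.A i, FOSDgtF (payMass G p i bi) (payMass G p i ai)) → p i ai = 0

def IsFOSDQRE {N : ℕ} (G : Game N) (p : Profile G) : Prop :=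
  (∀ i, ∀ ai : G.A i, 0 < p i ai) ∧
  ∀ i, ∀ ai bi : G.A i,
    FOSDgeF (payMass G p i ai) (payMass G p i bi) → p i bi ≤ p i ai

def IsMinMaxMean {N : ℕ} (l1 l2 l3 : ℝ) (G : Game N) (p : Profile G) : Prop :=
  ∀ i, ∀ ai : G.A i,
    p i ai = Real.exp (l1 * minPay G i ai + l2 * expPay G p i ai + l3 * maxPay G i ai) /
      ∑ bi, Real.exp (l1 * minPay G i bi + l2 * expPay G p i bi + l3 * maxPay G i bi)

def CompatibleEU {N : ℕ} (S : SolCon N) : Prop :=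
  ∃ f : ℝ → ℝ, StrictMono f ∧ Continuous f ∧
    ∀ G, ∀ p ∈ S G, ∀ i, ∀ ai bi : G.A i,
      expPayOf G p i bi f < expPayOf G p i ai f → p i bi ≤ p i ai

/-! ## Lotteries as compactly supported probability measures on ℝ -/

/-- Convolution of measures: distribution of the sum of independent draws. -/
def mconv (μ ν : Measure ℝ) : Measure ℝ := (μ.prod ν).map (fun z : ℝ × ℝ => z.1 + z.2)

/-- `npow μ m` is the `m`-fold convolution `μ^m`. -/
def npow (μ : Measure ℝ) : ℕ → Measure ℝ
  | 0 => Measure.dirac 0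
  | n + 1 => mconv (npow μ n) μ

/-- The distribution of `β` times a draw from `μ`. -/
def mscale (β : ℝ) (μ : Measure ℝ) : Measure ℝ := μ.map (fun x => β * x)

/-- `μ` is compactly supported. -/
def CompSupp (μ : Measure ℝ) : Prop := ∃ a b : ℝ, μ (Set.Icc a b)ᶜ = 0

/-- The minimum of the support of `μ`. -/
def minSupp (μ : Measure ℝ) : ℝ := sSup {x : ℝ | μ (Set.Iio x) = 0}

/-- The maximum of the support of `μ`. -/
def maxSupp (μ : Measure ℝ) : ℝ := sInf {x : ℝ | μ (Set.Ioi x) = 0}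

/-- Weak first-order stochastic dominance of `μ` over `ν`. -/
def FOSDgeM (μ ν : Measure ℝ) : Prop := ∀ t, μ (Set.Iic t) ≤ ν (Set.Iic t)

/-- Strict first-order stochastic dominance of `μ` over `ν`. -/
def FOSDgtM (μ ν : Measure ℝ) : Prop := FOSDgeM μ ν ∧ μ ≠ ν

/-- Monotone additive statistic on compactly supported lotteries (as measures). -/
def MASm (Φ : Measure ℝ → ℝ) : Prop :=
  (∀ c : ℝ, Φ (Measure.dirac c) = c) ∧
  (∀ μ ν : Measure ℝ, IsProbabilityMeasure μ → IsProbabilityMeasure ν →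
    CompSupp μ → CompSupp ν → Φ (mconv μ ν) = Φ μ + Φ ν) ∧
  (∀ μ ν : Measure ℝ, IsProbabilityMeasure μ → IsProbabilityMeasure ν →
    CompSupp μ → CompSupp ν → FOSDgeM μ ν → Φ ν ≤ Φ μ)

/-! ## Two-player games, unbundled -/

/-- `p` is a probability distribution on the finite type `α`. -/
def IsDist {α : Type*} [Fintype α] (p : α → ℝ) : Prop :=
  (∀ a, 0 ≤ p a) ∧ ∑ a, p a = 1

/-- Payoff lottery of player 1 playing `a` against the mixed strategy `q`. -/
def mass1 {α β : Type*} [Fintype β] (u : α → β → ℝ) (q : β → ℝ) (a : α) : ℝ → ℝ :=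
  fun t => ∑ b, if u a b = t then q b else 0

/-- Payoff lottery of player 2 playing `b` against the mixed strategy `p`. -/
def mass2 {α β : Type*} [Fintype α] (u : α → β → ℝ) (p : α → ℝ) (b : β) : ℝ → ℝ :=
  fun t => ∑ a, if u a b = t then p a else 0

/-- The distribution of a random variable on the uniform space `{1,…,m}`. -/
def distOf {m : ℕ} (X : Fin m → ℝ) : ℝ → ℝ :=
  fun t => (∑ ω : Fin m, if X ω = t then (1 : ℝ) else 0) / m

/-! ## Lotteries as elements of the convolution algebra -/

/-- The convolution algebra of finitely supported signed measures on `ℝ`. -/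
abbrev Lot := AddMonoidAlgebra ℝ ℝ

/-- The point mass at `x`, with total mass `w`. -/
abbrev Lot.pt (x w : ℝ) : Lot := AddMonoidAlgebra.single x w

/-- Integration of the function `f`. -/
def ev (f : ℝ → ℝ) : Lot →ₗ[ℝ] ℝ :=
  (Finsupp.linearCombination ℝ f) ∘ₗ (AddMonoidAlgebra.coeffLinearEquiv ℝ).toLinearMap

open Lot

theorem ev_apply (f : ℝ → ℝ) (X : Lot) : ev f X = X.coeff.sum fun x w => w * f x := by
  simp [ev, Finsupp.linearCombination_apply]

@[simp] theorem ev_pt (f : ℝ → ℝ) (x w : ℝ) : ev f (pt x w) = w * f x := by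
  simp [ev_apply, pt]

@[simp] theorem ev_one (f : ℝ → ℝ) : ev f (1 : Lot) = f 0 := by
  rw [AddMonoidAlgebra.one_def]; simp

theorem ev_mul (f : ℝ → ℝ) (X Y : Lot) :
    ev f (X * Y) = ev (fun x => ev (fun y => f (x + y)) Y) X := by
  induction X using AddMonoidAlgebra.induction_linear with
  | zero => simp
  | add X X' hX hX' => simp [add_mul, hX, hX']
  | single x w =>
    induction Y using AddMonoidAlgebra.induction_linear with
    | zero => simp
    | add Y Y' hY hY' => rw [mul_add, map_add, hY, hY']; simp [mul_add]
    | single y v => simp [AddMonoidAlgebra.single_mul_single, mul_assoc]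

theorem ev_congr {f g : ℝ → ℝ} {X : Lot} (h : ∀ x, X.coeff x ≠ 0 → f x = g x) :
    ev f X = ev g X := by
  simp only [ev_apply, Finsupp.sum]
  exact Finset.sum_congr rfl fun x hx => by rw [h x (Finsupp.mem_support_iff.1 hx)]

theorem ev_add (f g : ℝ → ℝ) (X : Lot) : ev (fun x => f x + g x) X = ev f X + ev g X := by
  simp [ev_apply, Finsupp.sum, mul_add, Finset.sum_add_distrib]

theorem ev_const_mul (c : ℝ) (f : ℝ → ℝ) (X : Lot) :
    ev (fun x => c * f x) X = c * ev f X := by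
  simp only [ev_apply, Finsupp.sum, Finset.mul_sum]
  exact Finset.sum_congr rfl fun x _ => by ring

theorem ev_indicator (X : Lot) (t : ℝ) : ev (fun x => if x = t then 1 else 0) X = X.coeff t := by
  simp only [ev_apply, Finsupp.sum, mul_ite, mul_one, mul_zero, Finset.sum_ite_eq',
    Finsupp.mem_support_iff]
  split_ifs with h
  · rfl
  · exact (not_not.1 h).symm

/-- `X` is a probability distribution. -/
structure IsLot (X : Lot) : Prop where
  nonneg : ∀ x, 0 ≤ X.coeff x
  mass : ev (fun _ => 1) X = 1

theorem ev_mono {X : Lot} (hX : ∀ x, 0 ≤ X.coeff x) {f g : ℝ → ℝ}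
    (h : ∀ x, X.coeff x ≠ 0 → f x ≤ g x) : ev f X ≤ ev g X := by
  simp only [ev_apply, Finsupp.sum]
  exact Finset.sum_le_sum fun x hx =>
    mul_le_mul_of_nonneg_left (h x (Finsupp.mem_support_iff.1 hx)) (hX x)

theorem ev_nonneg {X : Lot} (hX : ∀ x, 0 ≤ X.coeff x) {f : ℝ → ℝ} (h : ∀ x, 0 ≤ f x) :
    0 ≤ ev f X := by
  simp only [ev_apply, Finsupp.sum]
  exact Finset.sum_nonneg fun x _ => mul_nonneg (hX x) (h x)

theorem IsLot.ev_const {X : Lot} (hX : IsLot X) (c : ℝ) : ev (fun _ => c) X = c := by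
  simpa [hX.mass] using ev_const_mul c (fun _ => 1) X

theorem IsLot.mul {X Y : Lot} (hX : IsLot X) (hY : IsLot Y) : IsLot (X * Y) where
  nonneg t := by
    rw [← ev_indicator, ev_mul]
    refine ev_nonneg hX.nonneg fun x => ev_nonneg hY.nonneg fun y => ?_
    split_ifs <;> norm_num
  mass := by simp [ev_mul, hX.mass, hY.mass]

theorem IsLot.pt (x : ℝ) : IsLot (pt x 1) where
  nonneg t := by rw [← ev_indicator]; simp; split_ifs <;> norm_num
  mass := by simp

theorem IsLot.one : IsLot 1 := IsLot.pt 0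

theorem IsLot.pow {X : Lot} (hX : IsLot X) (n : ℕ) : IsLot (X ^ n) := by
  induction n with
  | zero => simpa using IsLot.one
  | succ n ih => rw [pow_succ]; exact ih.mul hX

/-- Cumulative distribution function. -/
def cdf (X : Lot) (t : ℝ) : ℝ := ev (fun x => if x ≤ t then 1 else 0) X

/-- Weak first-order stochastic dominance of `X` over `Y`. -/
def Dom (X Y : Lot) : Prop := ∀ t, cdf X t ≤ cdf Y t

theorem Dom.rfl {X : Lot} : Dom X X := fun _ => le_rfl

theorem Dom.trans {X Y Z : Lot} (h : Dom X Y) (h' : Dom Y Z) : Dom X Z :=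
  fun t => (h t).trans (h' t)

theorem cdf_mul (X Y : Lot) (t : ℝ) : cdf (X * Y) t = ev (fun x => cdf Y (t - x)) X := by
  simp only [cdf, ev_mul, le_sub_iff_add_le']

theorem Dom.mul_left {X Y Z : Lot} (h : Dom X Y) (hZ : IsLot Z) : Dom (Z * X) (Z * Y) := by
  intro t
  rw [cdf_mul, cdf_mul]
  exact ev_mono hZ.nonneg fun x _ => h _

theorem Dom.mul {X Y X' Y' : Lot} (h : Dom X Y) (h' : Dom X' Y') (hY : IsLot Y)
    (hX' : IsLot X') : Dom (X * X') (Y * Y') := by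
  refine Dom.trans ?_ (h'.mul_left hY)
  rw [mul_comm X, mul_comm Y]
  exact h.mul_left hX'

theorem dom_pt {x y : ℝ} (h : y ≤ x) : Dom (pt x 1) (pt y 1) := by
  intro t
  simp only [cdf, ev_pt, one_mul]
  split_ifs <;> linarith

/-- Every point of the support is at least `a`. -/
def SuppGe (X : Lot) (a : ℝ) : Prop := ∀ x, X.coeff x ≠ 0 → a ≤ x

theorem SuppGe.mul {X Y : Lot} {a b : ℝ} (hX : SuppGe X a) (hY : SuppGe Y b) :
    SuppGe (X * Y) (a + b) := by
  intro t ht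
  by_contra! hlt
  refine ht ?_
  rw [← ev_indicator, ev_mul]
  have : ∀ x, X.coeff x ≠ 0 → ev (fun y => if x + y = t then (1 : ℝ) else 0) Y = 0 := by
    intro x hx
    rw [ev_congr (g := fun y => 0 * 0)]
    · rw [ev_const_mul]; simp
    · intro y hy
      have := hX x hx
      have := hY y hy
      rw [if_neg (by linarith)]; simp
  rw [ev_congr (g := fun y => 0 * 0)]
  · rw [ev_const_mul]; simp
  · intro x hx
    rw [this x hx]; simp

theorem SuppGe.pow {X : Lot} {a : ℝ} (hX : SuppGe X a) (n : ℕ) : SuppGe (X ^ n) (n * a) := by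
  induction n with
  | zero =>
    intro x hx
    rw [pow_zero, ← ev_indicator, ev_one] at hx
    simp at hx
    simp [← hx]
  | succ n ih => rw [pow_succ]; push_cast; rw [add_mul, one_mul]; exact ih.mul hX

theorem coeff_mul_ge {X Y : Lot} (hX : IsLot X) (hY : IsLot Y) (a b : ℝ) :
    X.coeff a * Y.coeff b ≤ (X * Y).coeff (a + b) := by
  rw [← ev_indicator (X * Y), ev_mul, mul_comm, ← ev_indicator X, ← ev_const_mul]
  refine ev_mono hX.nonneg fun x _ => ?_
  rw [← ev_indicator Y]
  split_ifs with h
  · subst h; simp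
  · rw [mul_zero]
    refine ev_nonneg hY.nonneg fun y => ?_
    split_ifs <;> norm_num

theorem coeff_pow_ge {X : Lot} (hX : IsLot X) (a : ℝ) (n : ℕ) :
    X.coeff a ^ n ≤ (X ^ n).coeff (n * a) := by
  induction n with
  | zero => rw [← ev_indicator]; simp
  | succ n ih =>
    rw [pow_succ, pow_succ]; push_cast; rw [add_mul, one_mul]
    exact (mul_le_mul_of_nonneg_right ih (hX.nonneg a)).trans (coeff_mul_ge (hX.pow n) hX _ _)

/-- Mean. -/
def mean (X : Lot) : ℝ := ev (fun x => x) X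

/-- Variance. -/
def vari (X : Lot) : ℝ := ev (fun x => (x - mean X) ^ 2) X

theorem IsLot.mean_mul {X Y : Lot} (hX : IsLot X) (hY : IsLot Y) :
    mean (X * Y) = mean X + mean Y := by
  have h (x : ℝ) : ev (fun y => x + y) Y = x + mean Y := by
    rw [ev_add (fun _ => x) (fun y => y), hY.ev_const, mean]
  rw [mean, ev_mul, funext h, ev_add (fun x => x) (fun _ => mean Y), hX.ev_const]
  rfl

theorem ev_sq_pow {X : Lot} (hX : IsLot X) (n : ℕ) :
    ev (fun x => (x - n * mean X) ^ 2) (X ^ n) = n * vari X := by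
  induction n with
  | zero => simp
  | succ n ih =>
    rw [pow_succ, ev_mul]
    have : ∀ x : ℝ, ev (fun y => (x + y - ((n + 1 : ℕ) : ℝ) * mean X) ^ 2) X
        = (x - n * mean X) ^ 2 + vari X := by
      intro x
      have : (fun y => (x + y - ((n + 1 : ℕ) : ℝ) * mean X) ^ 2) = fun y =>
          ((x - n * mean X) ^ 2 + ((2 * (x - n * mean X)) * y +
            (-(2 * (x - n * mean X)) * mean X))) + (y - mean X) ^ 2 := by
        funext y; push_cast; ring
      rw [this, ev_add, ev_add, ev_add, ev_const_mul, hX.ev_const, hX.ev_const, vari]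
      have : ev (fun x => x) X = mean X := _root_.rfl
      rw [this]; ring
    simp only [this, ev_add, ih, (hX.pow n).ev_const]
    push_cast; ring

theorem cdf_le_one {X : Lot} (hX : IsLot X) (t : ℝ) : cdf X t ≤ 1 := by
  rw [← hX.mass]
  exact ev_mono hX.nonneg fun x _ => by split_ifs <;> norm_num

theorem cdf_eq_zero {X : Lot} {a t : ℝ} (h : SuppGe X a) (ht : t < a) : cdf X t = 0 := by
  rw [cdf, ev_congr (g := fun y => 0 * 0)]
  · rw [ev_const_mul]; simp
  · intro x hx
    have := h x hx
    rw [if_neg (by linarith)]; simp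

theorem cdf_le_one_sub {X : Lot} (hX : IsLot X) {a t : ℝ} (ht : t < a) :
    cdf X t ≤ 1 - X.coeff a := by
  rw [le_sub_iff_add_le, ← ev_indicator, cdf, ← ev_add]
  refine (ev_mono hX.nonneg fun x _ => ?_).trans_eq hX.mass
  split_ifs <;> linarith

/-- Chebyshev's inequality for convolution powers. -/
theorem cdf_pow_le {X : Lot} (hX : IsLot X) {d : ℝ} (hd : 0 < d) {n : ℕ} (hn : 0 < n) {t : ℝ}
    (ht : t ≤ n * (mean X - d)) : cdf (X ^ n) t ≤ vari X / d ^ 2 / n := by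
  have hn' : (0 : ℝ) < n := by exact_mod_cast hn
  have h : cdf (X ^ n) t ≤ ev (fun x => ((n * d) ^ 2)⁻¹ * (x - n * mean X) ^ 2) (X ^ n) := by
    refine ev_mono (hX.pow n).nonneg fun x _ => ?_
    split_ifs with hx
    · rw [← div_eq_inv_mul, le_div_iff₀ (by positivity)]
      have : n * d ≤ n * mean X - x := by nlinarith
      have := mul_pos hn' hd
      nlinarith
    · positivity
  rw [ev_const_mul, ev_sq_pow hX] at h
  refine h.trans (le_of_eq ?_)
  field_simp

/-! ### Reflection -/

/-- The distribution of `-X`. -/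
def refl : Lot →+* Lot := AddMonoidAlgebra.mapDomainRingHom ℝ (-AddMonoidHom.id ℝ)

@[simp] theorem refl_pt (x w : ℝ) : refl (pt x w) = pt (-x) w := by
  simp [refl, AddMonoidAlgebra.mapDomainRingHom_apply, AddMonoidAlgebra.mapDomain_single]

theorem ev_refl (f : ℝ → ℝ) (X : Lot) : ev f (refl X) = ev (fun x => f (-x)) X := by
  induction X using AddMonoidAlgebra.induction_linear with
  | zero => simp
  | add X X' hX hX' => simp [hX, hX']
  | single x w => rw [refl_pt]; simp

theorem refl_refl (X : Lot) : refl (refl X) = X := by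
  induction X using AddMonoidAlgebra.induction_linear with
  | zero => simp
  | add X X' hX hX' => simp [hX, hX']
  | single x w => rw [refl_pt, refl_pt, neg_neg]

theorem coeff_refl (X : Lot) (x : ℝ) : (refl X).coeff x = X.coeff (-x) := by
  rw [← ev_indicator, ← ev_indicator, ev_refl]
  simp only [neg_eq_iff_eq_neg]

theorem IsLot.refl {X : Lot} (hX : IsLot X) : IsLot (refl X) where
  nonneg x := by rw [coeff_refl]; exact hX.nonneg _
  mass := by rw [ev_refl]; exact hX.mass

theorem mean_refl (X : Lot) : mean (refl X) = -mean X := by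
  rw [mean, ev_refl, mean]
  simpa using ev_const_mul (-1) (fun x => x) X

theorem exists_gap (F : Finset ℝ) (t : ℝ) : ∃ s < t, ∀ x ∈ F, x < t → x ≤ s := by
  induction F using Finset.induction with
  | empty => exact ⟨t - 1, by linarith, by simp⟩
  | insert a F _ ih =>
    obtain ⟨s, hs, h⟩ := ih
    by_cases ha : a < t
    · refine ⟨max s a, max_lt hs ha, fun x hx hxt => ?_⟩
      rcases Finset.mem_insert.1 hx with rfl | hx
      · exact le_max_right _ _
      · exact (h x hx hxt).trans (le_max_left _ _)
    · refine ⟨s, hs, fun x hx hxt => ?_⟩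
      rcases Finset.mem_insert.1 hx with rfl | hx
      · exact absurd hxt ha
      · exact h x hx hxt

theorem Dom.refl {X Y : Lot} (h : Dom X Y) (hX : IsLot X) (hY : IsLot Y) :
    Dom (refl Y) (refl X) := by
  classical
  intro t
  obtain ⟨s, hs, hF⟩ := exists_gap (X.coeff.support ∪ Y.coeff.support) (-t)
  have key : ∀ Z : Lot, IsLot Z → Z.coeff.support ⊆ X.coeff.support ∪ Y.coeff.support →
      cdf (Paper.refl Z) t = 1 - cdf Z s := by
    intro Z hZ hsub
    rw [eq_sub_iff_add_eq, cdf, ev_refl, cdf, ← ev_add]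
    refine (ev_congr fun x hx => ?_).trans hZ.mass
    have := hF x (hsub (Finsupp.mem_support_iff.2 hx))
    rcases lt_or_ge x (-t) with hxt | hxt
    · rw [if_neg (by linarith), if_pos (this hxt)]; norm_num
    · rw [if_pos (by linarith), if_neg (by linarith)]; norm_num
  rw [key X hX Finset.subset_union_left, key Y hY Finset.subset_union_right]
  linarith [h s]

/-! ### Bernoulli lotteries -/

/-- The lottery paying `c` with probability `p` and `0` otherwise. -/
def bern (p c : ℝ) : Lot := pt 0 (1 - p) + pt c p

theorem IsLot.bern {p : ℝ} (h0 : 0 ≤ p) (h1 : p ≤ 1) (c : ℝ) : IsLot (bern p c) where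
  nonneg t := by
    rw [← ev_indicator]
    simp only [Paper.bern, map_add, ev_pt]
    split_ifs <;> linarith
  mass := by simp [Paper.bern]

theorem refl_bern (p c : ℝ) : refl (bern p c) = bern (1 - p) c * pt (-c) 1 := by
  simp only [bern, map_add, refl_pt, add_mul, AddMonoidAlgebra.single_mul_single]
  rw [add_comm]
  simp

theorem bern_zero (p : ℝ) : bern p 0 = 1 := by
  rw [bern, ← AddMonoidAlgebra.single_add, AddMonoidAlgebra.one_def]; simp

theorem cdf_pt_bern_bern (a α β p q t : ℝ) :
    cdf (pt a 1 * (bern p α * bern q β)) t =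
      (1 - p) * ((1 - q) * (if a ≤ t then 1 else 0) + q * (if a + β ≤ t then 1 else 0)) +
        p * ((1 - q) * (if a + α ≤ t then 1 else 0) + q * (if a + (α + β) ≤ t then 1 else 0)) := by
  simp only [cdf, ev_mul, bern, map_add, ev_pt]
  simp

theorem dom_pt_bern_bern {X : Lot} (hX : IsLot X) {a α β p q : ℝ} (hα : 0 ≤ α) (hβ : 0 ≤ β)
    (hp0 : 0 ≤ p) (hp1 : p ≤ 1) (hq0 : 0 ≤ q) (hq1 : q ≤ 1) (ha : SuppGe X a)
    (hq : ∀ t, a ≤ t → t < a + β → cdf X t ≤ (1 - p) * (1 - q))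
    (hp : p ≤ X.coeff (a + (α + β))) :
    Dom X (pt a 1 * (bern p α * bern q β)) := by
  intro t
  have h1 : 0 ≤ 1 - p := by linarith
  have h2 : 0 ≤ 1 - q := by linarith
  have hpq := mul_nonneg hp0 hq0
  have hpq' := mul_nonneg hp0 h2
  have hpq'' := mul_nonneg h1 hq0
  rw [cdf_pt_bern_bern]
  rcases lt_or_ge t a with h | h
  · rw [cdf_eq_zero ha h]
    split_ifs <;> nlinarith
  rcases lt_or_ge t (a + β) with h' | h'
  · refine (hq t h h').trans ?_
    rw [if_pos h]
    split_ifs <;> nlinarith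
  rcases lt_or_ge t (a + (α + β)) with h'' | h''
  · refine (cdf_le_one_sub hX h'').trans ?_
    rw [if_pos h, if_pos h']
    split_ifs <;> nlinarith
  · refine (cdf_le_one hX t).trans ?_
    rw [if_pos h, if_pos h', if_pos h'', if_pos (by linarith)]
    nlinarith

/-- Large convolution powers of a lottery dominate a sum of two Bernoulli lotteries whose value is
almost determined by the minimum, the mean and the maximum of the lottery. -/
theorem exists_lower_approx {Q : Lot → ℝ → Prop} {lam A B : ℝ}
    (hmul : ∀ X Y r s, Q X r → Q Y s → Q (X * Y) (r + s))
    (hpt : ∀ c, Q (pt c 1) (lam * c))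
    (hlow : ∀ m : ℕ, 2 ≤ m → ∀ c : ℝ, 0 ≤ c → ∃ r, c * A ≤ r ∧ Q (bern (1 / m) c) r)
    (hhigh : ∀ ε : ℝ, 0 < ε → ∃ m : ℕ, 2 ≤ m ∧ ∀ c : ℝ, 0 ≤ c →
      ∃ r, c * (B - ε) ≤ r ∧ Q (bern (1 - 1 / m) c) r)
    (hAB : A ≤ B) {X : Lot} (hX : IsLot X) {m0 m1 : ℝ} (h0 : SuppGe X m0)
    (h1 : 0 < X.coeff m1) (hm0 : m0 ≤ mean X) (hm1 : mean X ≤ m1) {ε : ℝ} (hε : 0 < ε) :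
    ∃ N : ℕ, ∀ n : ℕ, N ≤ n → ∃ Y r, IsLot Y ∧ Q Y r ∧ Dom (X ^ n) Y ∧
      n * (lam * m0 + A * (m1 - m0) + (B - A) * (mean X - m0) - ε) ≤ r := by
  set μ := mean X with hμ
  obtain ⟨δ, hδ, hδε⟩ : ∃ δ > 0, (B - A) * δ ≤ ε / 2 := by
    have : 0 < B - A + 1 := by linarith
    refine ⟨ε / 2 / (B - A + 1), by positivity, ?_⟩
    rw [mul_div_assoc', div_le_iff₀ this]
    nlinarith
  obtain ⟨η, hη, hηε⟩ : ∃ η > 0, (μ - m0) * η ≤ ε / 2 := by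
    have : 0 < μ - m0 + 1 := by linarith
    refine ⟨ε / 2 / (μ - m0 + 1), by positivity, ?_⟩
    rw [mul_div_assoc', div_le_iff₀ this]
    nlinarith
  obtain ⟨K, hK, hhi⟩ := hhigh η hη
  have hK' : (2 : ℝ) ≤ K := by exact_mod_cast hK
  obtain ⟨N, hN⟩ := exists_nat_gt (2 * K * (vari X / δ ^ 2))
  refine ⟨N + 1, fun n hn => ?_⟩
  have hn0 : 0 < n := by omega
  have hnR : (0 : ℝ) < n := by exact_mod_cast hn0
  have hNn : (N : ℝ) ≤ n := by exact_mod_cast (by omega : N ≤ n)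
  obtain ⟨M, hM⟩ := exists_nat_gt (1 / X.coeff m1 ^ n)
  set μ' := max m0 (μ - δ) with hμ'
  have e0 : m0 ≤ μ' := le_max_left _ _
  have e1 : μ - δ ≤ μ' := le_max_right _ _
  have e2 : μ' ≤ μ := max_le hm0 (by linarith)
  have hα : (0 : ℝ) ≤ n * (m1 - μ') := mul_nonneg hnR.le (by linarith)
  have hβ : (0 : ℝ) ≤ n * (μ' - m0) := mul_nonneg hnR.le (by linarith)
  obtain ⟨r1, hr1, hQ1⟩ := hlow (M + 2) (by omega) _ hα
  obtain ⟨r2, hr2, hQ2⟩ := hhi _ hβ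
  have hM2 : (2 : ℝ) ≤ ((M + 2 : ℕ) : ℝ) := by push_cast; linarith [Nat.cast_nonneg (α := ℝ) M]
  have hp1 : 1 / ((M + 2 : ℕ) : ℝ) ≤ 1 / 2 := one_div_le_one_div_of_le (by norm_num) hM2
  have hp0 : 0 ≤ 1 / ((M + 2 : ℕ) : ℝ) := by positivity
  have hq1 : 1 / (K : ℝ) ≤ 1 / 2 := one_div_le_one_div_of_le (by norm_num) hK'
  have hq0 : 0 ≤ 1 / (K : ℝ) := by positivity
  refine ⟨_, _, (IsLot.pt (n * m0)).mul ((IsLot.bern hp0 (by linarith) _).mul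
    (IsLot.bern (p := 1 - 1 / (K : ℝ)) (by linarith) (by linarith) _)),
    hmul _ _ _ _ (hpt _) (hmul _ _ _ _ hQ1 hQ2), ?_, ?_⟩
  · refine dom_pt_bern_bern (hX.pow n) hα hβ hp0 (by linarith) (by linarith) (by linarith)
      (h0.pow n) ?_ ?_
    · intro t ht ht'
      have hlt : t < n * μ' := by nlinarith
      have hle : t ≤ n * (μ - δ) := by
        rcases le_total m0 (μ - δ) with h | h
        · rw [hμ', max_eq_right h] at hlt; exact hlt.le
        · rw [hμ', max_eq_left h] at hlt; linarith
      refine (cdf_pow_le hX hδ hn0 hle).trans ?_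
      have hs : vari X / δ ^ 2 / n ≤ 1 / 2 * (1 / (K : ℝ)) := by
        rw [div_mul_div_comm, div_le_div_iff₀ hnR (by linarith)]
        linarith
      have := mul_nonneg (sub_nonneg.2 hp1) hq0
      linarith
    · have hc : X.coeff m1 ^ n ≤ (X ^ n).coeff (n * m1) := coeff_pow_ge hX m1 n
      have : (n : ℝ) * m0 + (n * (m1 - μ') + n * (μ' - m0)) = n * m1 := by ring
      rw [this]
      refine le_trans ?_ hc
      have hpos : 0 < X.coeff m1 ^ n := by positivity
      rw [div_le_iff₀ (by linarith)]
      rw [div_lt_iff₀ hpos] at hM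
      push_cast
      linarith
  · have key : lam * m0 + A * (m1 - m0) + (B - A) * (μ - m0) - ε ≤
        lam * m0 + (m1 - μ') * A + (μ' - m0) * (B - η) := by
      have : (μ' - m0) * η ≤ (μ - m0) * η :=
        mul_le_mul_of_nonneg_right (by linarith) hη.le
      have : (B - A) * (μ - μ') ≤ (B - A) * δ := by
        apply mul_le_mul_of_nonneg_left <;> linarith
      linarith
    have := mul_le_mul_of_nonneg_left key hnR.le
    linarith

theorem exists_upper_approx {Q : Lot → ℝ → Prop} {lam A B : ℝ}
    (hmul : ∀ X Y r s, Q X r → Q Y s → Q (X * Y) (r + s))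
    (hpt : ∀ c, Q (pt c 1) (lam * c))
    (hlow : ∀ ε : ℝ, 0 < ε → ∃ m : ℕ, 2 ≤ m ∧ ∀ c : ℝ, 0 ≤ c →
      ∃ r, r ≤ c * (A + ε) ∧ Q (bern (1 / m) c) r)
    (hhigh : ∀ m : ℕ, 2 ≤ m → ∀ c : ℝ, 0 ≤ c → ∃ r, r ≤ c * B ∧ Q (bern (1 - 1 / m) c) r)
    (hAB : A ≤ B) {X : Lot} (hX : IsLot X) {m0 m1 : ℝ} (h0 : 0 < X.coeff m0)
    (h1 : ∀ x, X.coeff x ≠ 0 → x ≤ m1) (hm0 : m0 ≤ mean X) (hm1 : mean X ≤ m1) {ε : ℝ}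
    (hε : 0 < ε) :
    ∃ N : ℕ, ∀ n : ℕ, N ≤ n → ∃ Y r, IsLot Y ∧ Q Y r ∧ Dom Y (X ^ n) ∧
      r ≤ n * (lam * m0 + A * (m1 - m0) + (B - A) * (mean X - m0) + ε) := by
  obtain ⟨N, hN⟩ := exists_lower_approx (Q := fun Y r => Q (refl Y) (-r)) (lam := lam)
    (A := lam - B) (B := lam - A) (X := refl X) (m0 := -m1) (m1 := -m0) (ε := ε)
    (fun X Y r s hX hY => by
      rw [map_mul, neg_add]; exact hmul _ _ _ _ hX hY)
    (fun c => by rw [refl_pt, ← mul_neg]; exact hpt _)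
    (fun m hm c hc => by
      obtain ⟨r, hr, hQ⟩ := hhigh m hm c hc
      refine ⟨-(r + lam * (-c)), by linarith, ?_⟩
      rw [neg_neg, refl_bern]
      exact hmul _ _ _ _ hQ (hpt _))
    (fun η hη => by
      obtain ⟨m, hm, h⟩ := hlow η hη
      refine ⟨m, hm, fun c hc => ?_⟩
      obtain ⟨r, hr, hQ⟩ := h c hc
      refine ⟨-(r + lam * (-c)), by linarith, ?_⟩
      rw [neg_neg, refl_bern, sub_sub_cancel]
      exact hmul _ _ _ _ hQ (hpt _))
    (by linarith) hX.refl
    (fun x hx => by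
      rw [coeff_refl] at hx
      linarith [h1 _ hx])
    (by rw [coeff_refl, neg_neg]; exact h0)
    (by rw [mean_refl]; linarith) (by rw [mean_refl]; linarith) hε
  refine ⟨N, fun n hn => ?_⟩
  obtain ⟨Y, r, hY, hQ, hD, hr⟩ := hN n hn
  refine ⟨refl Y, -r, hY.refl, hQ, ?_, ?_⟩
  · rw [← refl_refl (X ^ n)]
    rw [← map_pow] at hD
    exact hD.refl (hX.pow n).refl hY
  · rw [mean_refl] at hr
    linarith

/-! ## Payoff lotteries of games -/

section Law

variable {N : ℕ} {G H : Game N}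

/-- The payoff lottery of action `ai` as an element of the convolution algebra. -/
def law (G : Game N) (p : Profile G) (i : Fin N) (ai : G.A i) : Lot :=
  ∑ a : (j : Fin N) → G.A j, pt (G.u a i) (weight G (Function.update p i (delta ai)) a)

theorem ev_law (f : ℝ → ℝ) (p : Profile G) (i : Fin N) (ai : G.A i) :
    ev f (law G p i ai) =
      ∑ a : (j : Fin N) → G.A j, weight G (Function.update p i (delta ai)) a * f (G.u a i) := by
  simp [law, map_sum]

theorem coeff_law (p : Profile G) (i : Fin N) (ai : G.A i) (t : ℝ) :
    (law G p i ai).coeff t = payMass G p i ai t := by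
  rw [← ev_indicator, ev_law]
  simp [payMass]

theorem cdfOf_payMass (p : Profile G) (i : Fin N) (ai : G.A i) (t : ℝ) :
    cdfOf (payMass G p i ai) t = cdf (law G p i ai) t := by
  rw [cdfOf, cdf, ev_apply, Finsupp.sum]
  simp only [← coeff_law, mul_ite, mul_one, mul_zero]
  refine finsum_eq_sum_of_support_subset _ fun x hx => ?_
  by_contra h
  simp only [Finset.mem_coe, Finsupp.mem_support_iff, not_not] at h
  simp [h] at hx

theorem mean_law (p : Profile G) (i : Fin N) (ai : G.A i) :
    mean (law G p i ai) = expPay G p i ai := by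
  rw [mean, ev_law, expPay]

theorem isMixed_update {p : Profile G} (hp : IsMixed G p) (i : Fin N) (ai : G.A i) :
    IsMixed G (Function.update p i (delta ai)) := by
  classical
  intro k
  rcases eq_or_ne k i with rfl | h
  · simp only [Function.update_self]
    refine ⟨fun b => ?_, ?_⟩
    · unfold delta; split_ifs <;> norm_num
    · simp [delta]
  · simp only [Function.update_of_ne h]
    exact hp k

theorem weight_nonneg {p : Profile G} (hp : IsMixed G p) (a : (j : Fin N) → G.A j) :
    0 ≤ weight G p a := Finset.prod_nonneg fun j _ => (hp j).1 _

theorem sum_weight {p : Profile G} (hp : IsMixed G p) : ∑ a, weight G p a = 1 := by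
  classical
  simp only [weight]
  rw [← Fintype.prod_sum]
  exact Finset.prod_eq_one fun j _ => (hp j).2

theorem weight_update_eq_zero (p : Profile G) {i : Fin N} {ai : G.A i}
    {a : (j : Fin N) → G.A j} (h : a i ≠ ai) :
    weight G (Function.update p i (delta ai)) a = 0 := by
  refine Finset.prod_eq_zero (Finset.mem_univ i) ?_
  simp [delta, h]

theorem weight_update_pos {p : Profile G} (hp : ∀ k b, 0 < p k b) {i : Fin N} {ai : G.A i}
    {a : (j : Fin N) → G.A j} (h : a i = ai) :
    0 < weight G (Function.update p i (delta ai)) a := by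
  refine Finset.prod_pos fun k _ => ?_
  rcases eq_or_ne k i with rfl | hk
  · simp [delta, h]
  · rw [Function.update_of_ne hk]; exact hp _ _

theorem isLot_law {p : Profile G} (hp : IsMixed G p) (i : Fin N) (ai : G.A i) :
    IsLot (law G p i ai) where
  nonneg t := by
    rw [← ev_indicator, ev_law]
    refine Finset.sum_nonneg fun a _ => mul_nonneg (weight_nonneg (isMixed_update hp i ai) a) ?_
    split_ifs <;> norm_num
  mass := by
    rw [ev_law]
    simpa using sum_weight (isMixed_update hp i ai)

/-- Action profiles of the composite game are pairs of action profiles. -/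
def compEquiv (G H : Game N) :
    (((j : Fin N) → G.A j) × ((j : Fin N) → H.A j)) ≃ ((j : Fin N) → (G.comp H).A j) where
  toFun c j := (c.1 j, c.2 j)
  invFun c := (fun j => (c j).1, fun j => (c j).2)
  left_inv _ := rfl
  right_inv _ := rfl

theorem delta_prod {α β : Type*} (a : α) (b : β) (c : α) (d : β) :
    delta (a, b) (c, d) = delta a c * delta b d := by
  by_cases h1 : c = a <;> by_cases h2 : d = b <;> simp [delta, h1, h2]

theorem law_comp (p : Profile G) (q : Profile H) (i : Fin N) (a : G.A i) (b : H.A i) :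
    law (G.comp H) (prodProfile p q) i (a, b) = law G p i a * law H q i b := by
  have h : law G p i a * law H q i b = ∑ c, ∑ d, _ := Finset.sum_mul_sum _ _ _ _
  rw [h]
  refine ((compEquiv G H).sum_comp _).symm.trans ?_
  rw [Fintype.sum_prod_type]
  refine Finset.sum_congr rfl fun c _ => Finset.sum_congr rfl fun d _ => ?_
  rw [AddMonoidAlgebra.single_mul_single]
  have : weight (G.comp H) (Function.update (prodProfile p q) i (delta (a, b)))
      (compEquiv G H (c, d)) = weight G (Function.update p i (delta a)) c *
        weight H (Function.update q i (delta b)) d := by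
    simp only [weight, ← Finset.prod_mul_distrib]
    refine Finset.prod_congr rfl fun k _ => ?_
    rcases eq_or_ne k i with rfl | hk
    · simp only [Function.update_self]
      exact delta_prod a b (c k) (d k)
    · simp only [Function.update_of_ne hk]
      rfl
  rw [this]
  rfl

theorem minPay_le (i : Fin N) (a : (j : Fin N) → G.A j) : minPay G i (a i) ≤ G.u a i := by
  refine (ciInf_le (Set.finite_range _).bddBelow a).trans_eq ?_
  rw [Function.update_eq_self]

theorem le_maxPay (i : Fin N) (a : (j : Fin N) → G.A j) : G.u a i ≤ maxPay G i (a i) := by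
  refine Eq.trans_le ?_ (le_ciSup (Set.finite_range _).bddAbove a)
  rw [Function.update_eq_self]

theorem coeff_law_ne_zero {p : Profile G} {i : Fin N} {ai : G.A i} {t : ℝ}
    (h : (law G p i ai).coeff t ≠ 0) : ∃ a : (j : Fin N) → G.A j, a i = ai ∧ G.u a i = t := by
  rw [coeff_law, payMass] at h
  obtain ⟨a, _, ha⟩ := Finset.exists_ne_zero_of_sum_ne_zero h
  refine ⟨a, ?_, ?_⟩
  · by_contra hne
    simp [weight_update_eq_zero p hne] at ha
  · by_contra hne
    simp [hne] at ha

theorem coeff_law_pos {p : Profile G} (hm : IsMixed G p) (hp : ∀ k b, 0 < p k b)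
    (i : Fin N) (a : (j : Fin N) → G.A j) : 0 < (law G p i (a i)).coeff (G.u a i) := by
  rw [coeff_law, payMass]
  refine Finset.sum_pos' (fun c _ => ?_) ⟨a, Finset.mem_univ _, ?_⟩
  · split_ifs
    · exact weight_nonneg (isMixed_update hm i _) c
    · exact le_rfl
  · rw [if_pos rfl]
    exact weight_update_pos hp rfl

theorem suppGe_law (p : Profile G) (i : Fin N) (ai : G.A i) :
    SuppGe (law G p i ai) (minPay G i ai) := by
  intro t ht
  obtain ⟨a, rfl, rfl⟩ := coeff_law_ne_zero ht
  exact minPay_le i a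

theorem le_maxPay_of_coeff_law (p : Profile G) (i : Fin N) (ai : G.A i) (t : ℝ)
    (ht : (law G p i ai).coeff t ≠ 0) : t ≤ maxPay G i ai := by
  obtain ⟨a, rfl, rfl⟩ := coeff_law_ne_zero ht
  exact le_maxPay i a

theorem coeff_law_minPay_pos {p : Profile G} (hm : IsMixed G p) (hp : ∀ k b, 0 < p k b)
    (i : Fin N) (ai : G.A i) : 0 < (law G p i ai).coeff (minPay G i ai) := by
  obtain ⟨a, ha⟩ := exists_eq_ciInf_of_finite
    (f := fun a : (j : Fin N) → G.A j => G.u (Function.update a i ai) i)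
  have := coeff_law_pos hm hp i (Function.update a i ai)
  rwa [Function.update_self, ha] at this

theorem coeff_law_maxPay_pos {p : Profile G} (hm : IsMixed G p) (hp : ∀ k b, 0 < p k b)
    (i : Fin N) (ai : G.A i) : 0 < (law G p i ai).coeff (maxPay G i ai) := by
  obtain ⟨a, ha⟩ := exists_eq_ciSup_of_finite
    (f := fun a : (j : Fin N) → G.A j => G.u (Function.update a i ai) i)
  have := coeff_law_pos hm hp i (Function.update a i ai)
  rwa [Function.update_self, ha] at this

theorem minPay_le_mean {p : Profile G} (hm : IsMixed G p) (i : Fin N) (ai : G.A i) :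
    minPay G i ai ≤ mean (law G p i ai) := by
  rw [← (isLot_law hm i ai).ev_const (minPay G i ai)]
  exact ev_mono (isLot_law hm i ai).nonneg (suppGe_law p i ai)

theorem mean_le_maxPay {p : Profile G} (hm : IsMixed G p) (i : Fin N) (ai : G.A i) :
    mean (law G p i ai) ≤ maxPay G i ai := by
  rw [← (isLot_law hm i ai).ev_const (maxPay G i ai)]
  exact ev_mono (isLot_law hm i ai).nonneg (le_maxPay_of_coeff_law p i ai)

end Law

/-! ## Games in which one player chooses a lottery generated by an indifferent opponent -/

section Duel

variable {N m : ℕ} {i j : Fin N} {X Y : Fin (m + 2) → ℝ}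

/-- Player `i` receives `X` evaluated at the action of `j` by playing `0`, and `Y` evaluated at the
action of `j` by playing any other action. All other players receive nothing. -/
def duel (i j : Fin N) (X Y : Fin (m + 2) → ℝ) : Game N where
  A _ := Fin (m + 2)
  fintypeA _ := inferInstance
  nonemptyA _ := inferInstance
  u a k := if k = i then (if a i = 0 then X (a j) else Y (a j)) else 0

theorem sum_pt_const (c : ℝ) {Ω : Type*} [Fintype Ω] (f : Ω → ℝ) :
    ∑ ω, pt c (f ω) = pt c (∑ ω, f ω) :=
  (map_sum (AddMonoidAlgebra.singleAddHom (R := ℝ) c) f Finset.univ).symm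

theorem sum_pt_prod {Ω : Type*} [Fintype Ω] (q : Fin N → Ω → ℝ) (hq : ∀ k, ∑ ω, q k ω = 1)
    (j : Fin N) (h : Ω → ℝ) :
    ∑ a : Fin N → Ω, pt (h (a j)) (∏ k, q k (a k)) = ∑ ω, pt (h ω) (q j ω) := by
  classical
  have : ∀ a : Fin N → Ω, pt (h (a j)) (∏ k, q k (a k)) =
      ∏ k, pt (if k = j then h (a k) else 0) (q k (a k)) := by
    intro a
    rw [AddMonoidAlgebra.prod_single]
    simp
  simp only [this]
  rw [← Fintype.prod_sum (fun k ω => pt (if k = j then h ω else 0) (q k ω)),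
    Finset.prod_eq_single j]
  · simp
  · intro k _ hk
    simp only [if_neg hk]
    rw [sum_pt_const, hq k]
    rfl
  · simp

theorem law_duel_zero {p : Profile (duel i j X Y)} (hp : IsMixed _ p) (hij : j ≠ i) :
    law (duel i j X Y) p i (0 : Fin (m + 2)) = ∑ ω : Fin (m + 2), pt (X ω) (p j ω) := by
  have hq := isMixed_update hp i (0 : Fin (m + 2))
  have := sum_pt_prod _ (fun k => (hq k).2) j X
  rw [Function.update_of_ne hij] at this
  refine Eq.trans (Finset.sum_congr rfl fun a _ => ?_) this
  by_cases ha : a i = (0 : Fin (m + 2))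
  · simp only [duel, if_true, ha]; rfl
  · have h0 := weight_update_eq_zero p ha
    rw [h0]
    rw [weight] at h0
    refine Eq.trans ?_ (congrArg (pt (X (a j))) h0.symm)
    simp

theorem law_duel_ne_zero {p : Profile (duel i j X Y)} (hp : IsMixed _ p) (hij : j ≠ i)
    {b : Fin (m + 2)} (hb : b ≠ 0) :
    law (duel i j X Y) p i b = ∑ ω : Fin (m + 2), pt (Y ω) (p j ω) := by
  have hq := isMixed_update (G := duel i j X Y) hp i b
  have := sum_pt_prod _ (fun k => (hq k).2) j Y
  rw [Function.update_of_ne hij] at this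
  refine Eq.trans (Finset.sum_congr rfl fun a _ => ?_) this
  by_cases ha : a i = b
  · have hu : (duel i j X Y).u a i = Y (a j) := by
      refine (if_pos rfl).trans (if_neg ?_)
      rw [ha]; exact hb
    rw [hu]; rfl
  · have h0 := weight_update_eq_zero (G := duel i j X Y) p ha
    rw [h0]
    rw [weight] at h0
    refine Eq.trans ?_ (congrArg (pt (Y (a j))) h0.symm)
    simp

theorem law_duel_other {p : Profile (duel i j X Y)} (hp : IsMixed _ p) {k : Fin N} (hk : k ≠ i)
    (b : Fin (m + 2)) : law (duel i j X Y) p k b = 1 := by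
  have hq := sum_weight (isMixed_update (G := duel i j X Y) hp k b)
  refine Eq.trans (Finset.sum_congr rfl fun a _ => ?_)
    ((sum_pt_const 0 _).trans (congrArg (pt 0) hq))
  simp only [duel, if_neg hk]

theorem duel_scale (α : ℝ) :
    ((duel i j X Y).scale α).u = (duel i j (fun ω => α * X ω) (fun ω => α * Y ω)).u := by
  funext a k
  simp only [duel, Game.scale]
  split_ifs <;> simp

theorem duel_permute (π : Equiv.Perm (Fin N)) :
    ((duel i j X Y).permute π).u = (duel (π.symm i) (π.symm j) X Y).u := by
  funext a k
  simp only [duel, Game.permute, Equiv.eq_symm_apply]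
  rfl

end Duel

/-! ## Consequences of the axioms -/

section Axioms

variable {N m : ℕ} {S : SolCon N} {i : Fin N} {X Y Z X' Y' : Lot} {r s r' : ℝ}

/-- The standing assumptions on a solution concept. -/
structure IsRegular (S : SolCon N) : Prop where
  two_le : 2 ≤ N
  sol : IsSolutionConcept S
  bracketing : Bracketing S
  monotone : DistributionMonotone S
  anonymous : Anonymity S
  scale : ScaleInvariant S
  interior : Interiority S

/-- In some solution of some game, player `i` has actions with payoff lotteries `X` and `Y` and
the log-ratio of their probabilities is `r`. -/
def Rel (S : SolCon N) (i : Fin N) (X Y : Lot) (r : ℝ) : Prop :=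
  ∃ G : Game N, ∃ p ∈ S G, ∃ a b : G.A i, law G p i a = X ∧ law G p i b = Y ∧
    Real.log (p i a) - Real.log (p i b) = r

theorem Rel.symm (h : Rel S i X Y r) : Rel S i Y X (-r) := by
  obtain ⟨G, p, hp, a, b, ha, hb, rfl⟩ := h
  exact ⟨G, p, hp, b, a, hb, ha, by ring⟩

theorem Rel.congr (h : Rel S i X Y r) (hX : X = X') (hY : Y = Y') (hr : r = r') :
    Rel S i X' Y' r' := hX ▸ hY ▸ hr ▸ h

namespace IsRegular

theorem isLot_left (hS : IsRegular S) (h : Rel S i X Y r) : IsLot X := by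
  obtain ⟨G, p, hp, a, b, rfl, rfl, rfl⟩ := h
  exact isLot_law ((hS.sol G).2 p hp) i a

theorem mul (hS : IsRegular S) (h : Rel S i X Y r) (h' : Rel S i X' Y' r') :
    Rel S i (X * X') (Y * Y') (r + r') := by
  obtain ⟨G, p, hp, a, b, rfl, rfl, rfl⟩ := h
  obtain ⟨H, q, hq, c, d, rfl, rfl, rfl⟩ := h'
  refine ⟨G.comp H, prodProfile p q, hS.bracketing G H p q hp hq, (a, c), (b, d),
    law_comp p q i a c, law_comp p q i b d, ?_⟩
  simp only [prodProfile]
  rw [Real.log_mul (hS.interior G p hp i a).ne' (hS.interior H q hq i c).ne',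
    Real.log_mul (hS.interior G p hp i b).ne' (hS.interior H q hq i d).ne']
  ring

theorem pow (hS : IsRegular S) (h : Rel S i X Y r) (n : ℕ) :
    Rel S i (X ^ (n + 1)) (Y ^ (n + 1)) ((n + 1) * r) := by
  induction n with
  | zero => simpa using h
  | succ n ih =>
    exact (hS.mul ih h).congr (pow_succ X _).symm (pow_succ Y _).symm (by push_cast; ring)

theorem nonneg_of_ne (hS : IsRegular S) (h : Rel S i X Y r) (hd : Dom X Y) (hne : X ≠ Y) :
    0 ≤ r := by
  obtain ⟨G, p, hp, a, b, rfl, rfl, rfl⟩ := h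
  have := hS.monotone G p hp i a b ⟨fun t => ?_, fun h => hne ?_⟩
  · linarith [Real.log_le_log (hS.interior G p hp i b) this]
  · rw [cdfOf_payMass, cdfOf_payMass]; exact hd t
  · ext t
    rw [coeff_law, coeff_law, h]

theorem exists_ne (hS : IsRegular S) (i : Fin N) : ∃ j, j ≠ i :=
  haveI : Nontrivial (Fin N) := Fin.nontrivial_iff_two_le.2 hS.two_le
  _root_.exists_ne i

theorem exists_rel_pt (hS : IsRegular S) (i : Fin N) (c d : ℝ) :
    ∃ s, Rel S i (pt c 1) (pt d 1) s := by
  obtain ⟨j, hj⟩ := hS.exists_ne i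
  obtain ⟨p, hp⟩ := (hS.sol (duel (m := 0) i j (fun _ => c) (fun _ => d))).1
  have hm := (hS.sol _).2 p hp
  have hc : ∀ c : ℝ, ∑ ω : Fin 2, pt c (p j ω) = pt c 1 := fun c =>
    (sum_pt_const c (p j)).trans (congrArg (pt c) (hm j).2)
  exact ⟨_, _, p, hp, (0 : Fin 2), (1 : Fin 2), (law_duel_zero hm hj).trans (hc c),
    (law_duel_ne_zero hm hj (by decide)).trans (hc d), rfl⟩

theorem nonneg (hS : IsRegular S) (h : Rel S i X Y r) (hd : Dom X Y) : 0 ≤ r := by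
  by_cases hne : X = Y
  swap
  · exact hS.nonneg_of_ne h hd hne
  subst hne
  obtain ⟨s, hs⟩ := hS.exists_rel_pt i 1 0
  have key : ∀ n : ℕ, 0 ≤ ((n : ℝ) + 1) * r + s := fun n => by
    have hX := (hS.isLot_left h).pow (n + 1)
    refine hS.nonneg_of_ne (hS.mul (hS.pow h n) hs) ((dom_pt zero_le_one).mul_left hX) fun he => ?_
    have := congrArg mean he
    rw [hX.mean_mul (.pt 1), hX.mean_mul (.pt 0)] at this
    simp [mean] at this
  by_contra! hr
  obtain ⟨n, hn⟩ := exists_nat_gt (s / (-r))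
  rw [div_lt_iff₀ (by linarith)] at hn
  nlinarith [key n]

theorem eq_zero (hS : IsRegular S) (h : Rel S i X X r) : r = 0 :=
  le_antisymm (by linarith [hS.nonneg h.symm Dom.rfl]) (hS.nonneg h Dom.rfl)

theorem unique (hS : IsRegular S) (h : Rel S i X Y r) (h' : Rel S i X Y r') : r = r' := by
  have := hS.eq_zero ((hS.mul h h'.symm).congr rfl (mul_comm Y X) rfl)
  linarith

theorem trans (hS : IsRegular S) (h : Rel S i X Y r) (h' : Rel S i Y Z s) (h'' : Rel S i X Z r') :
    r' = r + s := by
  have := hS.eq_zero ((hS.mul (hS.mul h h') h''.symm).congr (X' := X * Y * Z) rfl (by ring) rfl)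
  linarith

theorem le_of_dom (hS : IsRegular S) (h : Rel S i X Y r) (h' : Rel S i X' Y' r')
    (hd : Dom (X * Y') (Y * X')) :
    r' ≤ r := by
  linarith [hS.nonneg (hS.mul h h'.symm) hd]

theorem eq_of_law_eq (hS : IsRegular S) {G : Game N} {p : Profile G} (hp : p ∈ S G) {a b : G.A i}
    (h : law G p i a = law G p i b) : p i a = p i b := by
  have := hS.eq_zero (r := Real.log (p i a) - Real.log (p i b)) ⟨G, p, hp, a, b, rfl, h.symm, rfl⟩
  exact Real.log_injOn_pos (hS.interior G p hp i a) (hS.interior G p hp i b) (by linarith)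

end IsRegular

theorem mem_of_payoffs_eq {A : Fin N → Type} {f : ∀ i, Fintype (A i)} {n : ∀ i, Nonempty (A i)}
    {u u' : ((i : Fin N) → A i) → Fin N → ℝ} (h : u = u') {q : (i : Fin N) → A i → ℝ}
    (hq : q ∈ S ⟨A, f, n, u⟩) : q ∈ S ⟨A, f, n, u'⟩ := h ▸ hq

/-- The distribution of a random variable on a uniform space with `m + 2` points. -/
def unif (X : Fin (m + 2) → ℝ) : Lot := ∑ ω, pt (X ω) ((m + 2 : ℝ)⁻¹)

theorem unif_const (c : ℝ) : unif (fun _ : Fin (m + 2) => c) = pt c 1 := by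
  rw [unif, sum_pt_const]
  simp
  rw [mul_inv_cancel₀]
  positivity

theorem dom_unif {X Y : Fin (m + 2) → ℝ} (h : ∀ ω, Y ω ≤ X ω) : Dom (unif X) (unif Y) := by
  intro t
  simp only [cdf, unif, map_sum, ev_pt]
  refine Finset.sum_le_sum fun ω _ => mul_le_mul_of_nonneg_left ?_ (by positivity)
  split_ifs with h1 h2
  · exact le_rfl
  · exact absurd ((h ω).trans h1) h2
  · exact zero_le_one
  · exact le_rfl

namespace IsRegular

theorem prob_eq_of_forall_eq (hS : IsRegular S) {G : Game N} {p : Profile G} (hp : p ∈ S G)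
    {k : Fin N} (h : ∀ b c : G.A k, p k b = p k c) (b : G.A k) :
    p k b = (Fintype.card (G.A k) : ℝ)⁻¹ := by
  have h1 := ((hS.sol G).2 p hp k).2
  rw [Finset.sum_congr rfl fun c _ => h c b] at h1
  rw [Finset.sum_const, nsmul_eq_mul] at h1
  exact eq_inv_of_mul_eq_one_right h1

theorem duel_other (hS : IsRegular S) {i j k : Fin N} {X Y : Fin (m + 2) → ℝ}
    {p : Profile (duel i j X Y)} (hp : p ∈ S (duel i j X Y)) (hk : k ≠ i) (b : Fin (m + 2)) :
    p k b = (Fintype.card (Fin (m + 2)) : ℝ)⁻¹ := by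
  have hm := (hS.sol _).2 p hp
  exact hS.prob_eq_of_forall_eq hp (fun b c => hS.eq_of_law_eq hp
    ((law_duel_other hm hk b).trans (law_duel_other hm hk c).symm)) b

theorem rel_of_duel (hS : IsRegular S) {i j : Fin N} {X Y : Fin (m + 2) → ℝ}
    {p : Profile (duel i j X Y)} (hp : p ∈ S (duel i j X Y)) (hj : j ≠ i) :
    Rel S i (unif X) (unif Y)
      (Real.log (p i (0 : Fin (m + 2))) - Real.log (p i (1 : Fin (m + 2)))) := by
  have hm := (hS.sol _).2 p hp
  have hu : ∀ Z : Fin (m + 2) → ℝ, ∑ ω : Fin (m + 2), pt (Z ω) (p j ω) = unif Z := fun Z => by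
    refine Finset.sum_congr rfl fun ω _ => ?_
    rw [hS.duel_other hp hj ω]
    simp
  exact ⟨_, p, hp, (0 : Fin (m + 2)), (1 : Fin (m + 2)), (law_duel_zero hm hj).trans (hu X),
    (law_duel_ne_zero hm hj (by simp)).trans (hu Y), rfl⟩

theorem exists_rel_unif (hS : IsRegular S) (X Y : Fin (m + 2) → ℝ) :
    ∃ r, ∀ i, Rel S i (unif X) (unif Y) r := by
  obtain ⟨j, hj⟩ := hS.exists_ne ⟨0, by linarith [hS.two_le]⟩
  set k : Fin N := ⟨0, by linarith [hS.two_le]⟩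
  obtain ⟨p, hp⟩ := (hS.sol (duel k j X Y)).1
  refine ⟨Real.log (p k (0 : Fin (m + 2))) - Real.log (p k (1 : Fin (m + 2))), fun i => ?_⟩
  set π := Equiv.swap k i
  have hπ : π i = k := Equiv.swap_apply_right k i
  have hπ' : π.symm k = i := by rw [Equiv.symm_apply_eq, hπ]
  have h1 := hS.anonymous π _ p hp
  have h2 : (fun i => p (π i) : Profile (duel (π.symm k) (π.symm j) X Y)) ∈
      S (duel (π.symm k) (π.symm j) X Y) :=
    mem_of_payoffs_eq (duel_permute π) h1
  rw [hπ'] at h2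
  have h3 := hS.rel_of_duel h2 (by rw [Ne, Equiv.symm_apply_eq, hπ]; exact hj)
  have h4 : ∀ l, l = k → ∀ b : Fin (m + 2), (p l b : ℝ) = p k b := by
    rintro _ rfl b
    rfl
  exact h3.congr rfl rfl
    (congrArg₂ (fun x y => Real.log x - Real.log y) (h4 _ hπ 0) (h4 _ hπ 1))

theorem rel_scale (hS : IsRegular S) {X Y : Fin (m + 2) → ℝ} (h : Rel S i (unif X) (unif Y) 0)
    {α : ℝ} (hα : α ∈ Set.Ioo (0 : ℝ) 1) :
    Rel S i (unif fun ω => α * X ω) (unif fun ω => α * Y ω) 0 := by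
  obtain ⟨j, hj⟩ := hS.exists_ne i
  obtain ⟨p, hp⟩ := (hS.sol (duel i j X Y)).1
  have hm := (hS.sol _).2 p hp
  have h0 := hS.unique (hS.rel_of_duel hp hj) h
  have h01 : p i (0 : Fin (m + 2)) = p i (1 : Fin (m + 2)) :=
    Real.log_injOn_pos (hS.interior _ p hp i _) (hS.interior _ p hp i _) (by linarith)
  have h1 : ∀ b : Fin (m + 2), p i b = p i (1 : Fin (m + 2)) := fun b => by
    by_cases hb : b = 0
    · rw [hb, h01]
    · exact hS.eq_of_law_eq hp
        ((law_duel_ne_zero hm hj hb).trans (law_duel_ne_zero hm hj (by simp)).symm)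
  have h2 := hS.scale _ p hp (fun k b => ?_) α hα
  · have h3 : (p : Profile (duel i j (fun ω => α * X ω) (fun ω => α * Y ω))) ∈
        S (duel i j (fun ω => α * X ω) (fun ω => α * Y ω)) :=
      mem_of_payoffs_eq (duel_scale α) h2
    exact (hS.rel_of_duel h3 hj).congr rfl rfl h0
  · by_cases hk : k = i
    · subst hk
      exact hS.prob_eq_of_forall_eq hp (fun b c => (h1 b).trans (h1 c).symm) b
    · exact hS.duel_other hp hk b

end IsRegular

end Axioms

/-! ## The values of constants and of Bernoulli lotteries -/

section Values

variable {N m : ℕ} {S : SolCon N} {i : Fin N}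

theorem eq_mul_of_monotone_of_add {v : ℝ → ℝ} (hv : Monotone v)
    (hadd : ∀ x y, v (x + y) = v x + v y) (c : ℝ) : v c = v 1 * c := by
  let φ : ℝ →+ ℝ := AddMonoidHom.mk' v hadd
  have hz : ∀ k : ℤ, v k = k * v 1 := fun k => by
    have := map_zsmul φ k 1
    rw [zsmul_eq_mul, zsmul_eq_mul, mul_one] at this
    exact this
  have hn : ∀ n : ℕ, v (n * c) = n * v c := fun n => by
    have := map_nsmul φ n c
    rw [nsmul_eq_mul, nsmul_eq_mul] at this
    exact this
  have h1 : 0 ≤ v 1 := by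
    have h0 : v 0 = 0 := map_zero φ
    rw [← h0]
    exact hv zero_le_one
  have key : ∀ n : ℕ, n * |v c - v 1 * c| ≤ v 1 := fun n => by
    have ha := hv (Int.floor_le (n * c))
    have hb := hv (Int.lt_floor_add_one (n * c)).le
    rw [hadd] at hb
    rw [hz, hn] at ha hb
    have hc := mul_le_mul_of_nonneg_right (Int.floor_le (n * c)) h1
    have hd := mul_le_mul_of_nonneg_right (Int.lt_floor_add_one (n * c)).le h1
    rw [← abs_of_nonneg (Nat.cast_nonneg (α := ℝ) n), ← abs_mul, abs_le]
    constructor <;> nlinarith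
  by_contra hne
  have hpos : 0 < |v c - v 1 * c| := abs_pos.2 (sub_ne_zero.2 hne)
  obtain ⟨n, hn⟩ := exists_nat_gt (v 1 / |v c - v 1 * c|)
  rw [div_lt_iff₀ hpos] at hn
  exact absurd (key n) hn.not_ge

theorem cdf_bern (p c t : ℝ) :
    cdf (bern p c) t = (1 - p) * (if 0 ≤ t then 1 else 0) + p * (if c ≤ t then 1 else 0) := by
  simp only [cdf, bern, map_add, ev_pt]

theorem dom_one_bern {p c : ℝ} (h0 : 0 ≤ p) (hc : 0 ≤ c) : Dom (bern p c) 1 := by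
  intro t
  rw [cdf_bern, cdf, AddMonoidAlgebra.one_def, ev_pt]
  split_ifs <;> linarith

theorem dom_bern_pt {p c : ℝ} (h1 : p ≤ 1) (hc : 0 ≤ c) : Dom (pt c 1) (bern p c) := by
  intro t
  rw [cdf_bern, cdf, ev_pt]
  split_ifs <;> linarith

theorem unif_low (c : ℝ) :
    unif (fun ω : Fin (m + 2) => if ω = 0 then c else 0) = bern (1 / (m + 2 : ℕ)) c := by
  rw [unif, Fin.sum_univ_succ]
  simp only [Fin.succ_ne_zero, if_true, if_false, sum_pt_const]
  rw [bern, add_comm]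
  congr 2
  · simp
    field_simp
    ring
  · simp

theorem unif_high (c : ℝ) :
    unif (fun ω : Fin (m + 2) => if ω = 0 then 0 else c) = bern (1 - 1 / (m + 2 : ℕ)) c := by
  rw [unif, Fin.sum_univ_succ]
  simp only [Fin.succ_ne_zero, if_true, if_false, sum_pt_const]
  rw [bern]
  congr 2
  · simp
  · simp
    field_simp
    ring

namespace IsRegular

theorem exists_rate (hS : IsRegular S) :
    ∃ lam : ℝ, 0 ≤ lam ∧ ∀ c i, Rel S i (pt c 1) 1 (lam * c) := by
  have h : ∀ c : ℝ, ∃ r, ∀ i, Rel S i (pt c 1) 1 r := fun c => by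
    obtain ⟨r, hr⟩ := hS.exists_rel_unif (m := 0) (fun _ => c) (fun _ => 0)
    exact ⟨r, fun i => (hr i).congr (unif_const c) (unif_const 0) rfl⟩
  choose v hv using h
  have i : Fin N := ⟨0, by linarith [hS.two_le]⟩
  have hmono : Monotone v := fun c d hcd =>
    hS.le_of_dom (hv d i) (hv c i) (by rw [mul_one, one_mul]; exact dom_pt hcd)
  have hadd : ∀ c d, v (c + d) = v c + v d := fun c d =>
    hS.unique (hv (c + d) i) ((hS.mul (hv c i) (hv d i)).congr
      (by rw [AddMonoidAlgebra.single_mul_single, mul_one]) (mul_one 1) rfl)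
  have hlin := eq_mul_of_monotone_of_add hmono hadd
  refine ⟨v 1, ?_, fun c i => (hv c i).congr rfl rfl (hlin c)⟩
  have := hmono zero_le_one
  rw [hlin 0] at this
  linarith

variable {lam : ℝ}

/-- The value of a lottery on a uniform space is homogeneous. -/
theorem exists_value (hS : IsRegular S) (h0 : 0 ≤ lam)
    (hlam : ∀ c i, Rel S i (pt c 1) 1 (lam * c)) (m : ℕ) :
    ∃ v : (Fin (m + 2) → ℝ) → ℝ, (∀ X i, Rel S i (unif X) 1 (v X)) ∧
      ∀ α : ℝ, 0 < α → ∀ X, v (fun ω => α * X ω) = α * v X := by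
  have h : ∀ X : Fin (m + 2) → ℝ, ∃ r, ∀ i, Rel S i (unif X) 1 r := fun X => by
    obtain ⟨r, hr⟩ := hS.exists_rel_unif X (fun _ => 0)
    exact ⟨r, fun i => (hr i).congr rfl (unif_const 0) rfl⟩
  choose v hv using h
  refine ⟨v, hv, ?_⟩
  have i : Fin N := ⟨0, by linarith [hS.two_le]⟩
  have hconst : ∀ c, v (fun _ => c) = lam * c := fun c =>
    hS.unique ((hv _ i).congr (unif_const c) rfl rfl) (hlam c i)
  have hmono : ∀ X Y, (∀ ω, Y ω ≤ X ω) → v Y ≤ v X := fun X Y hXY =>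
    hS.le_of_dom (hv X i) (hv Y i) (by rw [mul_one, one_mul]; exact dom_unif hXY)
  have hrel : ∀ X Y, Rel S i (unif X) (unif Y) (v X - v Y) := fun X Y => by
    obtain ⟨r, hr⟩ := hS.exists_rel_unif X Y
    exact (hr i).congr rfl rfl (by linarith [hS.trans (hr i) (hv Y i) (hv X i)])
  rcases h0.eq_or_lt with rfl | hpos
  · have hz : ∀ X, v X = 0 := fun X => by
      have h1 := hmono _ X fun ω => (Set.finite_range X).bddAbove.choose_spec ⟨ω, rfl⟩
      have h2 := hmono X _ fun ω => (Set.finite_range X).bddBelow.choose_spec ⟨ω, rfl⟩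
      rw [hconst] at h1 h2
      linarith
    intro α _ X
    rw [hz, hz, mul_zero]
  · have hlt : ∀ α ∈ Set.Ioo (0 : ℝ) 1, ∀ X, v (fun ω => α * X ω) = α * v X := fun α hα X => by
      have h1 := (hrel X (fun _ => v X / lam)).congr (r' := 0) rfl rfl (by
        rw [hconst]; field_simp; ring)
      have h2 := hS.unique (hS.rel_scale h1 hα) (hrel _ _)
      rw [hconst] at h2
      have : lam * (α * (v X / lam)) = α * v X := by field_simp
      linarith
    intro α hα X
    rcases lt_trichotomy α 1 with h1 | rfl | h1
    · exact hlt α ⟨hα, h1⟩ X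
    · simp
    · have := hlt α⁻¹ ⟨inv_pos.2 hα, inv_lt_one_of_one_lt₀ h1⟩ (fun ω => α * X ω)
      simp only [inv_mul_cancel_left₀ hα.ne'] at this
      rw [this, mul_inv_cancel_left₀ hα.ne']

theorem exists_bern_value (hS : IsRegular S) (h0 : 0 ≤ lam)
    (hlam : ∀ c i, Rel S i (pt c 1) 1 (lam * c)) (m : ℕ) :
    ∃ f g : ℝ, ∀ c : ℝ, 0 ≤ c → ∀ i, Rel S i (bern (1 / (m + 2 : ℕ)) c) 1 (c * f) ∧
      Rel S i (bern (1 - 1 / (m + 2 : ℕ)) c) 1 (c * g) := by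
  obtain ⟨v, hv, hh⟩ := hS.exists_value h0 hlam m
  refine ⟨v fun ω => if ω = 0 then 1 else 0, v fun ω => if ω = 0 then 0 else 1, fun c hc i => ?_⟩
  rcases hc.eq_or_lt with rfl | hc
  · rw [bern_zero, bern_zero, zero_mul, zero_mul, and_self]
    exact (hlam 0 i).congr rfl rfl (mul_zero _)
  · rw [← hh c hc, ← hh c hc, ← unif_low, ← unif_high]
    simp only [mul_ite, mul_one, mul_zero]
    exact ⟨hv _ i, hv _ i⟩

theorem value_bern_mem (hS : IsRegular S) (hlam : ∀ c i, Rel S i (pt c 1) 1 (lam * c)) {p r : ℝ}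
    (hp0 : 0 ≤ p) (hp1 : p ≤ 1) (h : Rel S i (bern p 1) 1 r) : r ∈ Set.Icc 0 lam := by
  constructor
  · exact hS.nonneg h (dom_one_bern hp0 zero_le_one)
  · have := hS.le_of_dom (hlam 1 i) h (by
      rw [mul_one, one_mul]; exact dom_bern_pt hp1 zero_le_one)
    linarith

end IsRegular

/-- A value for the lotteries relevant to the approximation theorems: `lam` is the value of a unit
constant, `A` the limiting value of a rare unit gain and `B` that of an almost certain one. -/
structure IsCalibrated (S : SolCon N) (lam A B : ℝ) : Prop where
  nonneg : 0 ≤ A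
  le : A ≤ B
  le_lam : B ≤ lam
  const : ∀ c i, Rel S i (pt c 1) 1 (lam * c)
  low : ∀ m : ℕ, 2 ≤ m → ∃ f, A ≤ f ∧ ∀ c : ℝ, 0 ≤ c → ∀ i, Rel S i (bern (1 / m) c) 1 (c * f)
  low_approx : ∀ ε : ℝ, 0 < ε → ∃ m : ℕ, 2 ≤ m ∧ ∃ f ≤ A + ε, ∀ c : ℝ, 0 ≤ c →
    ∀ i, Rel S i (bern (1 / m) c) 1 (c * f)
  high : ∀ m : ℕ, 2 ≤ m → ∃ g ≤ B, ∀ c : ℝ, 0 ≤ c → ∀ i, Rel S i (bern (1 - 1 / m) c) 1 (c * g)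
  high_approx : ∀ ε : ℝ, 0 < ε → ∃ m : ℕ, 2 ≤ m ∧ ∃ g, B - ε ≤ g ∧ ∀ c : ℝ, 0 ≤ c →
    ∀ i, Rel S i (bern (1 - 1 / m) c) 1 (c * g)

theorem IsRegular.exists_isCalibrated (hS : IsRegular S) :
    ∃ lam A B : ℝ, IsCalibrated S lam A B := by
  obtain ⟨lam, h0, hlam⟩ := hS.exists_rate
  choose f g hfg using hS.exists_bern_value h0 hlam
  have i : Fin N := ⟨0, by linarith [hS.two_le]⟩
  have hm : ∀ k : ℕ, 0 ≤ 1 / ((k + 2 : ℕ) : ℝ) ∧ 1 / ((k + 2 : ℕ) : ℝ) ≤ 1 := fun k =>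
    ⟨by positivity, by
      rw [div_le_one (by positivity)]; exact_mod_cast (by omega : 1 ≤ k + 2)⟩
  have hf : ∀ k, f k ∈ Set.Icc 0 lam := fun k => hS.value_bern_mem hlam (hm k).1 (hm k).2
    (((hfg k 1 zero_le_one i).1).congr rfl rfl (one_mul _))
  have hg : ∀ k, g k ∈ Set.Icc 0 lam := fun k => hS.value_bern_mem hlam
    (sub_nonneg.2 (hm k).2) (sub_le_self _ (hm k).1)
    (((hfg k 1 zero_le_one i).2).congr rfl rfl (one_mul _))
  have hb : BddBelow (Set.range f) := ⟨0, by rintro _ ⟨k, rfl⟩; exact (hf k).1⟩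
  have ha : BddAbove (Set.range g) := ⟨lam, by rintro _ ⟨k, rfl⟩; exact (hg k).2⟩
  have hfg0 : f 0 = g 0 := by
    have h1 := hfg 0 1 zero_le_one i
    have := hS.unique h1.1 (h1.2.congr (by norm_num) rfl rfl)
    linarith
  refine ⟨lam, ⨅ k, f k, ⨆ k, g k, le_ciInf fun k => (hf k).1,
    (ciInf_le hb 0).trans (hfg0.trans_le (le_ciSup ha 0)), ciSup_le fun k => (hg k).2, hlam,
    fun m hm => ?_, fun ε hε => ?_, fun m hm => ?_, fun ε hε => ?_⟩
  · obtain ⟨k, rfl⟩ := Nat.exists_eq_add_of_le' hm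
    exact ⟨f k, ciInf_le hb k, fun c hc i => (hfg k c hc i).1⟩
  · obtain ⟨k, hk⟩ := exists_lt_of_ciInf_lt (lt_add_of_pos_right (⨅ k, f k) hε)
    exact ⟨k + 2, by omega, f k, hk.le, fun c hc i => (hfg k c hc i).1⟩
  · obtain ⟨k, rfl⟩ := Nat.exists_eq_add_of_le' hm
    exact ⟨g k, le_ciSup ha k, fun c hc i => (hfg k c hc i).2⟩
  · obtain ⟨k, hk⟩ := exists_lt_of_lt_ciSup (sub_lt_self (⨆ k, g k) hε)
    exact ⟨k + 2, by omega, g k, hk.le, fun c hc i => (hfg k c hc i).2⟩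

/-! ## Identification of choice probabilities -/

theorem IsRegular.sub_le_log_sub_log (hS : IsRegular S) {lam A B : ℝ} (hc : IsCalibrated S lam A B)
    {G : Game N} {p : Profile G} (hp : p ∈ S G) (i : Fin N) (a b : G.A i) :
    ((lam - B) * minPay G i a + (B - A) * expPay G p i a + A * maxPay G i a) -
      ((lam - B) * minPay G i b + (B - A) * expPay G p i b + A * maxPay G i b) ≤
      Real.log (p i a) - Real.log (p i b) := by
  have hm := (hS.sol G).2 p hp
  have hpos := hS.interior G p hp
  have hmul : ∀ X Y r s, Rel S i X 1 r → Rel S i Y 1 s → Rel S i (X * Y) 1 (r + s) :=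
    fun X Y r s h h' => (hS.mul h h').congr rfl (mul_one 1) rfl
  refine le_of_forall_pos_le_add fun ε hε => ?_
  obtain ⟨n₁, h₁⟩ := exists_lower_approx (Q := fun X r => Rel S i X 1 r) hmul
    (fun c => hc.const c i)
    (fun m hm c h => by
      obtain ⟨f, hf, hr⟩ := hc.low m hm
      exact ⟨c * f, mul_le_mul_of_nonneg_left hf h, hr c h i⟩)
    (fun ε hε => by
      obtain ⟨m, hm, f, hf, hr⟩ := hc.high_approx ε hε
      exact ⟨m, hm, fun c h => ⟨c * f, mul_le_mul_of_nonneg_left hf h, hr c h i⟩⟩)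
    hc.le (isLot_law hm i a) (suppGe_law p i a) (coeff_law_maxPay_pos hm hpos i a)
    (minPay_le_mean hm i a) (mean_le_maxPay hm i a) (half_pos hε)
  obtain ⟨n₂, h₂⟩ := exists_upper_approx (Q := fun X r => Rel S i X 1 r) hmul
    (fun c => hc.const c i)
    (fun ε hε => by
      obtain ⟨m, hm, f, hf, hr⟩ := hc.low_approx ε hε
      exact ⟨m, hm, fun c h => ⟨c * f, mul_le_mul_of_nonneg_left hf h, hr c h i⟩⟩)
    (fun m hm c h => by
      obtain ⟨f, hf, hr⟩ := hc.high m hm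
      exact ⟨c * f, mul_le_mul_of_nonneg_left hf h, hr c h i⟩)
    hc.le (isLot_law hm i b) (coeff_law_minPay_pos hm hpos i b) (le_maxPay_of_coeff_law p i b)
    (minPay_le_mean hm i b) (mean_le_maxPay hm i b) (half_pos hε)
  set n := max n₁ n₂
  obtain ⟨Y, r, hY, hQY, hdY, hr⟩ := h₁ (n + 1) ((le_max_left _ _).trans n.le_succ)
  obtain ⟨Z, s, hZ, hQZ, hdZ, hs⟩ := h₂ (n + 1) ((le_max_right _ _).trans n.le_succ)
  have hrel : Rel S i (law G p i a) (law G p i b) (Real.log (p i a) - Real.log (p i b)) :=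
    ⟨G, p, hp, a, b, rfl, rfl, rfl⟩
  have key := hS.le_of_dom (hS.pow hrel n)
    ((hS.mul hQY hQZ.symm).congr (mul_one Y) (one_mul Z) rfl)
    (by rw [mul_comm (law G p i b ^ (n + 1))]; exact hdY.mul hdZ hY hZ)
  rw [mean_law] at hr hs
  push_cast at hr hs
  have hn : (0 : ℝ) < n + 1 := by positivity
  refine le_of_mul_le_mul_left ?_ hn
  linarith

theorem eq_exp_div_sum_of_log_sub_log {Ω : Type*} [Fintype Ω] {q V : Ω → ℝ} (hq : ∀ a, 0 < q a)
    (hsum : ∑ a, q a = 1) (h : ∀ a b, V a - V b ≤ Real.log (q a) - Real.log (q b)) (a : Ω) :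
    q a = Real.exp (V a) / ∑ b, Real.exp (V b) := by
  have h1 : ∀ b, Real.exp (V b) = q b * (Real.exp (V a) / q a) := fun b => by
    rw [← Real.exp_log (hq a), ← Real.exp_log (hq b), ← Real.exp_sub, ← Real.exp_add]
    congr 1
    linarith [h a b, h b a]
  rw [Finset.sum_congr rfl fun b _ => h1 b, ← Finset.sum_mul, hsum, one_mul]
  rw [div_div_cancel₀ (Real.exp_pos _).ne']

end Values

/-- bracketing + distribution-monotonicity + anonymity + scale-invariance +
interiority imply that `S` refines `Min-Max-Mean_λ` for some `λ ∈ ℝ³_{≥0}`. -/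
theorem stmt7 {N : ℕ} (hN : 2 ≤ N) (S : SolCon N) (hS : IsSolutionConcept S)
    (hBr : Bracketing S) (hDM : DistributionMonotone S) (hAn : Anonymity S)
    (hSc : ScaleInvariant S) (hInt : Interiority S) :
    ∃ l1 l2 l3 : ℝ, 0 ≤ l1 ∧ 0 ≤ l2 ∧ 0 ≤ l3 ∧
      ∀ G, ∀ p ∈ S G, IsMinMaxMean l1 l2 l3 G p := by
  have hR : IsRegular S := ⟨hN, hS, hBr, hDM, hAn, hSc, hInt⟩
  obtain ⟨lam, A, B, hc⟩ := hR.exists_isCalibrated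
  refine ⟨lam - B, B - A, A, sub_nonneg.2 hc.le_lam, sub_nonneg.2 hc.le, hc.nonneg,
    fun G p hp i a => ?_⟩
  exact eq_exp_div_sum_of_log_sub_log (hInt G p hp i) ((hS G).2 p hp i).2
    (fun a b => hR.sub_le_log_sub_log hc hp i a b) a

end Paper
end
end

section
/- Let S be a statistic response equilibrium solution concept: either S(G) equals the set of all Nash_Φ equilibria of G for every game G (for some monotone additive statistic Φ for which this set is nonempty for every game), or S(G) equals the set of all LQRE_{λΦ} equilibria of G for every game G (for some monotone additive statistic Φ and some λ ≥ 0). Then S is compatible with expected utility if and only if there exist a∈ℝ and λ ≥ 0 such that S is Nash_{K_a} (i.e., S(G) is the set of Nash_{K_a} equilibria for every G) or S is LQRE_{λK_a} (i.e., S(G) is the set of LQRE_{λK_a} equilibria for every G). -/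
open Filter Topology MeasureTheory

noncomputable section

namespace Paper

/-! ### Mass functions of real random variables on finite spaces -/

/-- The mass function of `u` under the weights `w`. -/
def massOf {ι : Type*} [Fintype ι] (u w : ι → ℝ) : ℝ → ℝ :=
  fun t => ∑ a, if u a = t then w a else 0

section massOf

variable {ι : Type*} [Fintype ι]

lemma massOf_eq_sum_mul (u w : ι → ℝ) (t : ℝ) :
    massOf u w t = ∑ a, w a * (if u a = t then 1 else 0) := by
  simp [massOf]

lemma support_massOf_subset (u w : ι → ℝ) :
    Function.support (massOf u w) ⊆ (Finset.univ.image u : Finset ℝ) := by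
  intro t ht
  by_contra h
  refine ht (Finset.sum_eq_zero fun a _ => if_neg fun hat => h ?_)
  simpa using ⟨a, hat⟩

lemma finsum_mul_massOf (u w : ι → ℝ) (φ : ℝ → ℝ) :
    ∑ᶠ t, φ t * massOf u w t = ∑ a, w a * φ (u a) := by
  rw [finsum_eq_sum_of_support_subset (s := Finset.univ.image u)]
  · simp only [massOf, Finset.mul_sum]
    rw [Finset.sum_comm]
    refine Finset.sum_congr rfl fun a _ => ?_
    simp [mul_comm]
  · exact (Function.support_mul_subset_right _ _).trans (support_massOf_subset u w)

lemma isFinLottery_massOf {u w : ι → ℝ} (hw : IsDist w) : IsFinLottery (massOf u w) := by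
  refine ⟨fun t => Finset.sum_nonneg fun a _ => ?_, ?_, ?_⟩
  · split_ifs
    exacts [hw.1 a, le_rfl]
  · exact (Finset.finite_toSet _).subset (support_massOf_subset u w)
  · simpa [hw.2] using finsum_mul_massOf u w fun _ => 1

lemma massOf_const {w : ι → ℝ} (hw : IsDist w) (c : ℝ) : massOf (fun _ => c) w = delta c := by
  funext t
  simp only [massOf, delta]
  split_ifs with h h' h'
  · exact hw.2
  · exact absurd h.symm h'
  · exact absurd h'.symm h
  · simp

lemma isFinLottery_delta (c : ℝ) : IsFinLottery (delta c) := by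
  have hw : IsDist (fun _ : Unit => (1 : ℝ)) := ⟨fun _ => zero_le_one, by simp⟩
  rw [← massOf_const hw c]
  exact isFinLottery_massOf hw

lemma conv_massOf_delta (u w : ι → ℝ) (c : ℝ) :
    conv (massOf u w) (delta c) = massOf (fun a => u a + c) w := by
  funext z
  simp only [conv]
  rw [finsum_eq_single _ (z - c)]
  · simp [delta, massOf, eq_sub_iff_add_eq]
  · intro x hx
    have : z - x ≠ c := fun h => hx (by linarith)
    simp [delta, this]

lemma MAS.map_massOf_add_const {Φ : (ℝ → ℝ) → ℝ} (hΦ : MAS Φ) {u w : ι → ℝ} (hw : IsDist w)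
    (c : ℝ) : Φ (massOf (fun a => u a + c) w) = Φ (massOf u w) + c := by
  rw [← conv_massOf_delta, hΦ.2.1 _ _ (isFinLottery_massOf hw) (isFinLottery_delta c), hΦ.1]

end massOf

/-! ### The certainty equivalents `K_a` -/

/-- The utility function with constant absolute risk attitude `a`. -/
def caraUtility (a x : ℝ) : ℝ := if a = 0 then x else a⁻¹ * Real.exp (a * x)

lemma strictMono_caraUtility (a : ℝ) : StrictMono (caraUtility a) := by
  intro x y hxy
  unfold caraUtility
  split_ifs with ha
  · exact hxy
  rcases lt_or_gt_of_ne ha with h | h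
  · exact mul_lt_mul_of_neg_left (Real.exp_lt_exp.2 (mul_lt_mul_of_neg_left hxy h))
      (inv_lt_zero.2 h)
  · exact mul_lt_mul_of_pos_left (Real.exp_lt_exp.2 (mul_lt_mul_of_pos_left hxy h))
      (inv_pos.2 h)

lemma continuous_caraUtility (a : ℝ) : Continuous (caraUtility a) := by
  unfold caraUtility
  split_ifs
  · exact continuous_id
  · fun_prop

lemma caraUtility_Kreal {ι : Type*} [Fintype ι] (a : ℝ) {u w : ι → ℝ} (hw : IsDist w) :
    caraUtility a (Kreal a (massOf u w)) = ∑ i, w i * caraUtility a (u i) := by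
  by_cases ha : a = 0
  · subst ha
    simp only [caraUtility, Kreal, Kstat, expOf]
    simpa using finsum_mul_massOf u w fun x => x
  · have hpos : 0 < ∑ i, w i * Real.exp (a * u i) := by
      obtain ⟨i, -, hi⟩ : ∃ i ∈ Finset.univ, 0 < w i := by
        by_contra! h
        have := Finset.sum_nonpos h
        rw [hw.2] at this
        linarith
      exact Finset.sum_pos' (fun j _ => mul_nonneg (hw.1 j) (Real.exp_pos _).le)
        ⟨i, Finset.mem_univ i, mul_pos hi (Real.exp_pos _)⟩
    have h := finsum_mul_massOf u w fun x => Real.exp (a * x)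
    simp only [caraUtility, Kreal, Kstat, if_neg ha, EReal.coe_ne_top, EReal.coe_ne_bot,
      EReal.coe_eq_zero, EReal.toReal_coe, if_false, h]
    rw [mul_inv_cancel_left₀ ha, Real.exp_log hpos, Finset.mul_sum]
    exact Finset.sum_congr rfl fun i _ => by ring

/-! ### Payoff lotteries in games -/

section Games

variable {N : ℕ} {G : Game N} {p : Profile G}

lemma isDist_delta {α : Type*} [Fintype α] (a : α) : IsDist (delta a) := by
  classical
  refine ⟨fun b => ?_, ?_⟩
  · unfold delta
    split_ifs <;> norm_num
  · simp [delta]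

lemma IsMixed.update_delta (hp : IsMixed G p) (i : Fin N) (ai : G.A i) :
    IsMixed G (Function.update p i (delta ai)) := by
  intro j
  by_cases h : j = i
  · subst h
    rw [Function.update_self]
    exact isDist_delta ai
  · simpa [Function.update_of_ne h] using hp j

lemma IsMixed.sum_weight_mul (hp : IsMixed G p) (k : Fin N) (g : G.A k → ℝ) :
    ∑ a, weight G p a * g (a k) = ∑ t, p k t * g t := by
  classical
  have h : ∀ a : (j : Fin N) → G.A j, weight G p a * g (a k) =
      ∏ j, Function.update p k (fun t => p k t * g t) j (a j) := by
    intro a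
    unfold weight
    rw [← Finset.mul_prod_erase _ _ (Finset.mem_univ k),
      ← Finset.mul_prod_erase _ (fun j => Function.update p k _ j (a j)) (Finset.mem_univ k),
      Function.update_self, Finset.prod_congr rfl fun j hj => ?_]
    · ring
    · rw [Function.update_of_ne (Finset.ne_of_mem_erase hj)]
  simp only [h]
  rw [← Fintype.prod_sum, ← Finset.mul_prod_erase _ _ (Finset.mem_univ k), Function.update_self,
    Finset.prod_eq_one fun j hj => ?_, mul_one]
  rw [Function.update_of_ne (Finset.ne_of_mem_erase hj)]
  exact (hp j).2

lemma IsMixed.isDist_weight (hp : IsMixed G p) (i : Fin N) : IsDist (weight G p) :=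
  ⟨fun a => Finset.prod_nonneg fun j _ => (hp j).1 (a j), by
    simpa [(hp i).2] using hp.sum_weight_mul i fun _ => 1⟩

lemma weight_update_delta_eq_zero {i : Fin N} {ai : G.A i} {a : (j : Fin N) → G.A j}
    (h : a i ≠ ai) : weight G (Function.update p i (delta ai)) a = 0 :=
  Finset.prod_eq_zero (Finset.mem_univ i) (by simp [delta, h])

lemma payMass_eq_massOf (i : Fin N) (ai : G.A i) :
    payMass G p i ai =
      massOf (fun a => G.u a i) (weight G (Function.update p i (delta ai))) := rfl

lemma expPayOf_of_payMass_eq {ι : Type*} [Fintype ι] {u w : ι → ℝ} {i : Fin N} {ai : G.A i}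
    (h : payMass G p i ai = massOf u w) (f : ℝ → ℝ) :
    expPayOf G p i ai f = ∑ a, w a * f (u a) := by
  rw [← finsum_mul_massOf, ← h, payMass_eq_massOf, finsum_mul_massOf, expPayOf]

/-- If the payoff of `i` from `ai` depends only on the action of another player `k`, then the
payoff lottery is the push-forward of the strategy of `k`. -/
lemma IsMixed.payMass_eq (hp : IsMixed G p) {i k : Fin N} (hk : k ≠ i) {ai : G.A i}
    {g : G.A k → ℝ} (hg : ∀ a, a i = ai → G.u a i = g (a k)) :
    payMass G p i ai = massOf g (p k) := by
  funext t
  rw [payMass_eq_massOf, massOf_eq_sum_mul, massOf_eq_sum_mul]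
  have h := (hp.update_delta i ai).sum_weight_mul k fun s => if g s = t then 1 else 0
  rw [Function.update_of_ne hk] at h
  rw [← h]
  refine Finset.sum_congr rfl fun a _ => ?_
  by_cases ha : a i = ai
  · rw [hg a ha]
  · rw [weight_update_delta_eq_zero ha, zero_mul, zero_mul]

lemma IsMixed.payMass_eq_delta (hp : IsMixed G p) {i : Fin N} {ai : G.A i} {c : ℝ}
    (hc : ∀ a, a i = ai → G.u a i = c) : payMass G p i ai = delta c := by
  rw [← massOf_const ((hp.update_delta i ai).isDist_weight i) c, payMass_eq_massOf]
  funext t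
  refine Finset.sum_congr rfl fun a _ => ?_
  by_cases ha : a i = ai
  · simp only [hc a ha]
  · rw [weight_update_delta_eq_zero ha, ite_self, ite_self]

end Games

/-! ### Compatibility of `K_a`-based equilibria -/

lemma Kreal_lt_of_expPayOf_lt {N : ℕ} {G : Game N} {p : Profile G} (hp : IsMixed G p) {a : ℝ}
    {i : Fin N} {ai bi : G.A i}
    (h : expPayOf G p i bi (caraUtility a) < expPayOf G p i ai (caraUtility a)) :
    Kreal a (payMass G p i bi) < Kreal a (payMass G p i ai) := by
  refine (strictMono_caraUtility a).lt_iff_lt.1 ?_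
  rw [payMass_eq_massOf, payMass_eq_massOf,
    caraUtility_Kreal a ((hp.update_delta i bi).isDist_weight i),
    caraUtility_Kreal a ((hp.update_delta i ai).isDist_weight i)]
  exact h

lemma compatibleEU_of_nash_Kreal {N : ℕ} {S : SolCon N} {a : ℝ}
    (hS : ∀ G, S G = {p : Profile G | IsMixed G p ∧ IsNashPhi (Kreal a) G p}) :
    CompatibleEU S := by
  refine ⟨caraUtility a, strictMono_caraUtility a, continuous_caraUtility a, ?_⟩
  intro G p hp i ai bi h
  rw [hS] at hp
  by_contra! hlt
  have h1 := hp.2 i bi (((hp.1 i).1 ai).trans_lt hlt) ai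
  exact h1.not_gt (Kreal_lt_of_expPayOf_lt hp.1 h)

lemma compatibleEU_of_lqre_Kreal {N : ℕ} {S : SolCon N} {a lam : ℝ} (hlam : 0 ≤ lam)
    (hS : ∀ G, S G = {p : Profile G | IsMixed G p ∧ IsLQREPhi (Kreal a) lam G p}) :
    CompatibleEU S := by
  refine ⟨caraUtility a, strictMono_caraUtility a, continuous_caraUtility a, ?_⟩
  intro G p hp i ai bi h
  rw [hS] at hp
  rw [hp.2 i ai, hp.2 i bi]
  have := (Kreal_lt_of_expPayOf_lt hp.1 h).le
  gcongr

/-! ### Compatibility makes `Φ` agree with expected utility -/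

/-- The game in which the payoff of `i` is `u` (when playing `t`) or `v` (otherwise), evaluated
at the action of `k`; the payoff of `k` is `r` of the own action; all others get `0`. -/
def choiceGame {N : ℕ} (i k : Fin N) (T : Type) [Fintype T] [Nonempty T] [DecidableEq T] (t : T)
    (u v r : T → ℝ) : Game N where
  A := fun _ => T
  fintypeA := fun _ => inferInstance
  nonemptyA := fun _ => inferInstance
  u := fun a j =>
    if j = i then (if a i = t then u (a k) else v (a k)) else if j = k then r (a k) else 0

/-- `Φ` ranks lotteries with positive weights in agreement with expected `f`-utility. -/
def AgreesEU (Φ : (ℝ → ℝ) → ℝ) (f : ℝ → ℝ) : Prop :=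
  ∀ (T : Type) [Fintype T] [Nontrivial T] (w u v : T → ℝ), IsDist w → (∀ t, 0 < w t) →
    ∑ t, w t * f (u t) < ∑ t, w t * f (v t) → Φ (massOf u w) ≤ Φ (massOf v w)

section choiceGame

variable {N : ℕ} {i k : Fin N} {T : Type} [Fintype T] [Nonempty T] [DecidableEq T] {t : T}
  {u v r : T → ℝ} {p : Profile (choiceGame i k T t u v r)}

lemma payMass_choiceGame_left (hki : k ≠ i) (hp : IsMixed _ p) :
    payMass _ p i t = massOf u (p k) :=
  hp.payMass_eq hki fun a ha => by
    simp only [choiceGame, if_true]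
    exact if_pos ha

lemma payMass_choiceGame_right (hki : k ≠ i) (hp : IsMixed _ p) {s : T} (hs : s ≠ t) :
    payMass _ p i s = massOf v (p k) :=
  hp.payMass_eq hki fun a ha => by
    simp only [choiceGame, if_true]
    exact if_neg fun h => hs (ha.symm.trans h)

lemma payMass_choiceGame_of_ne (hp : IsMixed _ p) {j : Fin N} (hj : j ≠ i) (s : T) :
    payMass _ p j s = delta (if j = k then r s else 0) :=
  hp.payMass_eq_delta fun a ha => by
    simp only [choiceGame, if_neg hj]
    split_ifs with h
    · subst h
      exact congrArg r ha
    · rfl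

lemma expPayOf_choiceGame_lt (hki : k ≠ i) (hp : IsMixed _ p) {f : ℝ → ℝ} {s : T} (hs : s ≠ t)
    {w : T → ℝ} (hw : p k = w) (h : ∑ x, w x * f (u x) < ∑ x, w x * f (v x)) :
    expPayOf _ p i t f < expPayOf _ p i s f := by
  subst hw
  exact ((expPayOf_of_payMass_eq (payMass_choiceGame_left hki hp) f).trans_lt h).trans_eq
    (expPayOf_of_payMass_eq (payMass_choiceGame_right hki hp hs) f).symm

end choiceGame

lemma agreesEU_of_nash {N : ℕ} (hN : 2 ≤ N) {S : SolCon N} {Φ : (ℝ → ℝ) → ℝ}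
    (hS : ∀ G, S G = {p : Profile G | IsMixed G p ∧ IsNashPhi Φ G p}) {f : ℝ → ℝ}
    (hf : ∀ G, ∀ p ∈ S G, ∀ i, ∀ ai bi : G.A i,
      expPayOf G p i bi f < expPayOf G p i ai f → p i bi ≤ p i ai) : AgreesEU Φ f := by
  classical
  intro T _ _ w u v hw _ h
  by_contra! hlt
  obtain ⟨t, s, hts⟩ := exists_pair_ne T
  let i : Fin N := ⟨0, by omega⟩
  let k : Fin N := ⟨1, by omega⟩
  have hki : k ≠ i := by simp [i, k]
  let G := choiceGame i k T t u v fun _ => 0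
  let p : Profile G := fun j => if j = k then w else delta t
  have hpk : p k = w := if_pos rfl
  have hpj : ∀ j, j ≠ k → p j = delta t := fun j hj => if_neg hj
  have hp : IsMixed G p := by
    intro j
    by_cases hj : j = k
    · rw [hj, hpk]
      exact hw
    · rw [hpj j hj]
      exact isDist_delta t
  have hnash : IsNashPhi Φ G p := by
    intro j a ha b
    by_cases hj : j = i
    · subst hj
      rw [hpj _ hki.symm] at ha
      have hat : a = t := by
        by_contra hat
        exact ha.ne' (if_neg hat)
      rw [hat, payMass_choiceGame_left hki hp, hpk]
      by_cases hb : b = t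
      · rw [hb, payMass_choiceGame_left hki hp, hpk]
      · rw [payMass_choiceGame_right hki hp hb, hpk]
        exact hlt.le
    · exact ((congrArg Φ (payMass_choiceGame_of_ne hp hj b)).trans
        (congrArg Φ (payMass_choiceGame_of_ne hp hj a)).symm).le
  have hmem : p ∈ S G := by
    rw [hS]
    exact ⟨hp, hnash⟩
  have h1 := hf G p hmem i s t (expPayOf_choiceGame_lt hki hp hts.symm hpk h)
  rw [hpj _ hki.symm] at h1
  simp [delta, hts.symm] at h1
  linarith

lemma agreesEU_of_lqre {N : ℕ} (hN : 2 ≤ N) {S : SolCon N} (hne : ∀ G, (S G).Nonempty)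
    {Φ : (ℝ → ℝ) → ℝ} (hΦ : MAS Φ) {lam : ℝ} (hlam : 0 < lam)
    (hS : ∀ G, S G = {p : Profile G | IsMixed G p ∧ IsLQREPhi Φ lam G p}) {f : ℝ → ℝ}
    (hf : ∀ G, ∀ p ∈ S G, ∀ i, ∀ ai bi : G.A i,
      expPayOf G p i bi f < expPayOf G p i ai f → p i bi ≤ p i ai) : AgreesEU Φ f := by
  classical
  intro T _ _ w u v hw hpos h
  obtain ⟨t, s, hts⟩ := exists_pair_ne T
  let i : Fin N := ⟨0, by omega⟩
  let k : Fin N := ⟨1, by omega⟩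
  have hki : k ≠ i := by simp [i, k]
  let G := choiceGame i k T t u v fun x => Real.log (w x) / lam
  obtain ⟨p, hmem⟩ := hne G
  have hp : IsMixed G p ∧ IsLQREPhi Φ lam G p := by
    rw [hS] at hmem
    exact hmem
  have hval : ∀ x : T, Real.exp (lam * Φ (payMass G p k x)) = w x := by
    intro x
    rw [payMass_choiceGame_of_ne hp.1 hki, hΦ.1, if_pos rfl, mul_div_cancel₀ _ hlam.ne',
      Real.exp_log (hpos x)]
  have hpk : p k = w := by
    funext x
    have hx := hp.2 k x
    have : ∑ y, Real.exp (lam * Φ (payMass G p k y)) = 1 := by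
      rw [← hw.2]
      exact Finset.sum_congr rfl fun y _ => hval y
    rw [this, div_one] at hx
    exact hx.trans (hval x)
  have h1 := hf G p hmem i s t (expPayOf_choiceGame_lt hki hp.1 hts.symm hpk h)
  rw [hp.2 i t, hp.2 i s, payMass_choiceGame_left hki hp.1,
    payMass_choiceGame_right hki hp.1 hts.symm, hpk] at h1
  have hZ : 0 < ∑ b, Real.exp (lam * Φ (payMass G p i b)) :=
    Finset.sum_pos (fun _ _ => Real.exp_pos _) Finset.univ_nonempty
  exact le_of_mul_le_mul_left (Real.exp_le_exp.1 ((div_le_div_iff_of_pos_right hZ).1 h1)) hlam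

/-! ### Certainty equivalents -/

lemma AgreesEU.map_eq_of_pos {Φ : (ℝ → ℝ) → ℝ} {f : ℝ → ℝ} (h : AgreesEU Φ f) (hΦ : MAS Φ)
    (hf : StrictMono f) (hc : Continuous f) {T : Type} [Fintype T] [Nontrivial T] {w u : T → ℝ}
    (hw : IsDist w) (hpos : ∀ t, 0 < w t) : f (Φ (massOf u w)) = ∑ t, w t * f (u t) := by
  have hconv : Convex ℝ (Set.range f) := (isPreconnected_range hc).ordConnected.convex
  obtain ⟨c, hfc⟩ : ∑ t, w t • f (u t) ∈ Set.range f :=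
    hconv.sum_mem (fun t _ => hw.1 t) hw.2 fun t _ => Set.mem_range_self _
  simp only [smul_eq_mul] at hfc
  have hconst : ∀ d : ℝ, ∑ t, w t * f d = f d := fun d => by rw [← Finset.sum_mul, hw.2, one_mul]
  rw [← hfc]
  congr 1
  refine le_antisymm (le_of_forall_gt_imp_ge_of_dense fun d hd => ?_)
    (le_of_forall_lt_imp_le_of_dense fun d hd => ?_)
  · have := h T w u (fun _ => d) hw hpos (by rw [hconst, ← hfc]; exact hf hd)
    rwa [massOf_const hw, hΦ.1] at this
  · have := h T w (fun _ => d) u hw hpos (by rw [hconst, ← hfc]; exact hf hd)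
    rwa [massOf_const hw, hΦ.1] at this

lemma AgreesEU.map_eq {Φ : (ℝ → ℝ) → ℝ} {f : ℝ → ℝ} (h : AgreesEU Φ f) (hΦ : MAS Φ)
    (hf : StrictMono f) (hc : Continuous f) {ι : Type} [Fintype ι] {w u : ι → ℝ}
    (hw : IsDist w) : f (Φ (massOf u w)) = ∑ a, w a * f (u a) := by
  classical
  let T := Bool × {a // 0 < w a}
  let w' : T → ℝ := fun x => w x.2 / 2
  have hsum : ∀ g : ι → ℝ, ∑ x : T, w' x * g x.2 = ∑ a, w a * g a := by
    intro g
    have h1 : ∑ x : {a // 0 < w a}, w x * g x = ∑ a, w a * g a := by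
      rw [← Finset.sum_subtype (Finset.univ.filter (0 < w ·)) (by simp) fun a => w a * g a]
      exact Finset.sum_filter_of_ne fun a _ ha =>
        (hw.1 a).lt_of_ne fun h0 => ha (by rw [← h0, zero_mul])
    rw [Fintype.sum_prod_type, Fintype.sum_bool, ← h1, ← Finset.sum_add_distrib]
    exact Finset.sum_congr rfl fun x _ => by simp only [w']; ring
  have hmass : massOf (fun x : T => u x.2) w' = massOf u w := by
    funext t
    rw [massOf_eq_sum_mul, massOf_eq_sum_mul]
    exact hsum fun a => if u a = t then 1 else 0
  have hpos : ∀ x : T, 0 < w' x := fun x => half_pos x.2.2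
  have hw' : IsDist w' := ⟨fun x => (hpos x).le, by simpa [hw.2] using hsum fun _ => 1⟩
  have : Nonempty {a // 0 < w a} := by
    by_contra hempty
    rw [not_nonempty_iff] at hempty
    have := hw'.2
    simp [T] at this
  rw [← hmass, h.map_eq_of_pos hΦ hf hc hw' hpos]
  exact hsum fun a => f (u a)

/-! ### Utility functions with translation-invariant certainty equivalents -/

lemma eq_mul_of_continuous_of_map_add {g : ℝ → ℝ} (hg : Continuous g)
    (hadd : ∀ x y, g (x + y) = g x + g y) (x : ℝ) : g x = g 1 * x := by
  have := map_real_smul (AddMonoidHom.mk' g hadd) hg x 1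
  simpa [mul_comm] using this

lemma exists_caraUtility_of_pexider {F : ℝ → ℝ} (hc : Continuous F) (hF0 : F 0 = 0)
    (h1 : F 1 = 1) {κ : ℝ}
    (hadd : ∀ x y, F (x + y) = F x + F y + κ * F x * F y) :
    ∃ a α β : ℝ, ∀ x, F x = α * caraUtility a x + β := by
  by_cases hκ : κ = 0
  · refine ⟨0, 1, 0, fun x => ?_⟩
    have := eq_mul_of_continuous_of_map_add hc (fun x y => by simp [hadd x y, hκ]) x
    simp [caraUtility, this, h1]
  let m : ℝ → ℝ := fun x => 1 + κ * F x
  have hm : ∀ x y, m (x + y) = m x * m y := fun x y => by simp only [m, hadd]; ring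
  have hm0 : ∀ x, m x ≠ 0 := by
    intro x hx
    have := hm x (-x)
    rw [hx, add_neg_cancel, zero_mul] at this
    simp [m, hF0] at this
  have hmpos : ∀ x, 0 < m x := by
    intro x
    have := hm (x / 2) (x / 2)
    rw [add_halves] at this
    rw [this]
    exact mul_self_pos.2 (hm0 _)
  have hlog : Continuous fun x => Real.log (m x) :=
    Continuous.log (by simp only [m]; fun_prop) hm0
  have hlin := eq_mul_of_continuous_of_map_add hlog fun x y => by rw [hm, Real.log_mul (hm0 x) (hm0 y)]
  set a := Real.log (m 1) with ha
  have hexp : ∀ x, Real.exp (a * x) = 1 + κ * F x := fun x => by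
    rw [← hlin x, Real.exp_log (hmpos x)]
  have ha0 : a ≠ 0 := by
    intro h
    have := hexp 1
    rw [h, h1] at this
    simp at this
    exact hκ this
  refine ⟨a, a / κ, -1 / κ, fun x => ?_⟩
  rw [caraUtility, if_neg ha0, hexp]
  field_simp
  ring

lemma exists_caraUtility_of_shift {f : ℝ → ℝ} (hf : StrictMono f) (hc : Continuous f)
    (hshift : ∀ x y z q c : ℝ, 0 ≤ q → q ≤ 1 → f z = (1 - q) * f x + q * f y →
      f (z + c) = (1 - q) * f (x + c) + q * f (y + c)) :
    ∃ a α β : ℝ, ∀ x, f x = α * caraUtility a x + β := by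
  have hdet : ∀ x y z c : ℝ, x < y → x ≤ z → z ≤ y →
      (f y - f x) * f (z + c) = (f y - f z) * f (x + c) + (f z - f x) * f (y + c) := by
    intro x y z c hxy hxz hzy
    have hd : 0 < f y - f x := sub_pos.2 (hf hxy)
    have hxz' := hf.monotone hxz
    have hzy' := hf.monotone hzy
    have := hshift x y z ((f z - f x) / (f y - f x)) c (by apply div_nonneg <;> linarith)
      ((div_le_one hd).2 (by linarith)) (by field_simp; ring)
    rw [this]
    field_simp
    ring
  have h01 : 0 < f 1 - f 0 := sub_pos.2 (hf one_pos)
  have hdet' : ∀ z c : ℝ,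
      (f 1 - f 0) * f (z + c) = (f 1 - f z) * f (0 + c) + (f z - f 0) * f (1 + c) := by
    intro z c
    rcases le_total z 0 with hz | hz
    · have := hdet z 1 0 c (by linarith) hz zero_le_one
      linarith
    rcases le_total z 1 with hz' | hz'
    · exact hdet 0 1 z c one_pos hz hz'
    · have := hdet 0 z 1 c (by linarith) zero_le_one hz'
      linarith
  let F : ℝ → ℝ := fun x => (f x - f 0) / (f 1 - f 0)
  have hfF : ∀ x, f x = (f 1 - f 0) * F x + f 0 := fun x => by
    simp only [F]
    field_simp
    ring
  have hF1 : F 1 = 1 := div_self h01.ne'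
  have hF0 : F 0 = 0 := by simp [F]
  have hFadd : ∀ z c, F (z + c) = F c + F z * (F (1 + c) - F c) := by
    intro z c
    have := hdet' z c
    rw [zero_add, hfF (z + c), hfF c, hfF z, hfF (1 + c)] at this
    refine mul_left_cancel₀ h01.ne' (mul_left_cancel₀ h01.ne' ?_)
    linear_combination this
  have hsymm : ∀ c, F (1 + c) - F c = 1 + (F (1 + 1) - 1 - 1) * F c := by
    intro c
    have h1 := hFadd 1 c
    have h2 := hFadd c 1
    rw [add_comm c 1, hF1] at h2
    rw [h2]
    ring
  obtain ⟨a, α, β, h⟩ := exists_caraUtility_of_pexider (F := F) (κ := F (1 + 1) - 1 - 1)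
    (by simp only [F]; fun_prop) hF0 hF1 fun x y => by rw [hFadd x y, hsymm]; ring
  refine ⟨a, (f 1 - f 0) * α, (f 1 - f 0) * β + f 0, fun x => ?_⟩
  rw [hfF x, h x]
  ring

lemma AgreesEU.exists_eq_Kreal {Φ : (ℝ → ℝ) → ℝ} {f : ℝ → ℝ} (h : AgreesEU Φ f) (hΦ : MAS Φ)
    (hf : StrictMono f) (hc : Continuous f) :
    ∃ a : ℝ, ∀ (ι : Type) [Fintype ι] (w u : ι → ℝ), IsDist w →
      Φ (massOf u w) = Kreal a (massOf u w) := by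
  obtain ⟨a, α, β, hfa⟩ := exists_caraUtility_of_shift hf hc fun x y z q c hq0 hq1 hz => by
    let w : Bool → ℝ := fun b => cond b q (1 - q)
    let u : Bool → ℝ := fun b => cond b y x
    have hw : IsDist w := ⟨fun b => by cases b <;> simp [w, hq0, hq1], by simp [w]⟩
    have h1 : Φ (massOf u w) = z := hf.injective <| by
      rw [h.map_eq hΦ hf hc hw, hz]
      simp [w, u, add_comm]
    have h2 := h.map_eq hΦ hf hc (u := fun b => u b + c) hw
    rw [hΦ.map_massOf_add_const hw, h1] at h2
    rw [h2]
    simp [w, u, add_comm]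
  refine ⟨a, fun ι _ w u hw => hf.injective ?_⟩
  rw [h.map_eq hΦ hf hc hw, hfa (Kreal a _), caraUtility_Kreal a hw]
  simp only [hfa, mul_add, Finset.sum_add_distrib, ← Finset.sum_mul, hw.2, Finset.mul_sum]
  rw [one_mul]
  congr 1
  exact Finset.sum_congr rfl fun i _ => by ring

/-- a statistic response equilibrium solution concept is compatible with
expected utility iff it is `Nash_{K_a}` or `LQRE_{λ K_a}` for some `a ∈ ℝ`, `λ ≥ 0`. -/
theorem stmt9 {N : ℕ} (hN : 2 ≤ N) (S : SolCon N) (hS : IsSolutionConcept S)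
    (hSRE : (∃ Φ : (ℝ → ℝ) → ℝ, MAS Φ ∧
              ∀ G : Game N, S G = {p : Profile G | IsMixed G p ∧ IsNashPhi Φ G p}) ∨
            (∃ Φ : (ℝ → ℝ) → ℝ, ∃ lam : ℝ, MAS Φ ∧ 0 ≤ lam ∧
              ∀ G : Game N, S G = {p : Profile G | IsMixed G p ∧ IsLQREPhi Φ lam G p})) :
    CompatibleEU S ↔
      ∃ a : ℝ, ∃ lam : ℝ, 0 ≤ lam ∧
        ((∀ G : Game N, S G = {p : Profile G | IsMixed G p ∧ IsNashPhi (Kreal a) G p}) ∨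
          (∀ G : Game N,
            S G = {p : Profile G | IsMixed G p ∧ IsLQREPhi (Kreal a) lam G p})) := by
  constructor
  · rintro ⟨f, hf, hc, hcomp⟩
    have hlottery : ∀ {Φ : (ℝ → ℝ) → ℝ}, MAS Φ → AgreesEU Φ f → ∃ a : ℝ, ∀ G : Game N,
        ∀ p : Profile G, IsMixed G p → ∀ i ai,
          Φ (payMass G p i ai) = Kreal a (payMass G p i ai) := by
      intro Φ hΦ hagree
      obtain ⟨a, ha⟩ := hagree.exists_eq_Kreal hΦ hf hc
      exact ⟨a, fun G p hp i ai => ha _ _ _ ((hp.update_delta i ai).isDist_weight i)⟩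
    rcases hSRE with ⟨Φ, hΦ, hSΦ⟩ | ⟨Φ, lam, hΦ, hlam, hSΦ⟩
    · obtain ⟨a, ha⟩ := hlottery hΦ (agreesEU_of_nash hN hSΦ hcomp)
      refine ⟨a, 0, le_rfl, Or.inl fun G => ?_⟩
      rw [hSΦ]
      ext p
      refine and_congr_right fun hp => ?_
      simp only [IsNashPhi, ha G p hp]
    · rcases hlam.eq_or_lt with rfl | hpos
      · refine ⟨0, 0, le_rfl, Or.inr fun G => ?_⟩
        rw [hSΦ]
        simp only [IsLQREPhi, zero_mul]
      · obtain ⟨a, ha⟩ := hlottery hΦ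
          (agreesEU_of_lqre hN (fun G => (hS G).1) hΦ hpos hSΦ hcomp)
        refine ⟨a, lam, hlam, Or.inr fun G => ?_⟩
        rw [hSΦ]
        ext p
        refine and_congr_right fun hp => ?_
        simp only [IsLQREPhi, ha G p hp]
  · rintro ⟨a, lam, hlam, h | h⟩
    · exact compatibleEU_of_nash_Kreal h
    · exact compatibleEU_of_lqre_Kreal hlam h

end Paper
end
end
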